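/- arXiv:1910.00206 — 3 statements merged into one kernel-verified Lean document; each statement's English description precedes it below -/
import Mathlib

section
/- Let v_1, …, v_d be LDP fan data. Then the data has exactly two singular cones (equivalently, the associated toric log del Pezzo surface X(Δ) has exactly two singular points) if and only if one of the following holds: (1) d = 3 and there exist integers p, q with p, q ≥ 2 and gcd(p, q) = 1 such that the data is equivalent to the data (1,0), (0,1), (−p,−q); (2) d = 4 and there exist integers p, q, r with p ≤ 1, r ≤ min{−pq−2, −2, −q−1, q−pq−1} and gcd(q, r) = 1 such that the data is equivalent to the data (1,0), (0,1), (−1,p), (q,r); (3) d = 5 and there exist integers p, q, r with p ≤ 0, 1 ≤ q ≤ −r−1 and gcd(q, r) = 1 such that the data is equivalent to the data (1,0), (0,1), (−1,p+1), (−1,p), (q,r). -/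
/-- The determinant `det(u, w) = u₁w₂ − u₂w₁` of two integer vectors. -/
def detZ (u w : ℤ × ℤ) : ℤ := u.1 * w.2 - u.2 * w.1

/-- The real vector associated to an integer vector. -/
noncomputable def toR2 (u : ℤ × ℤ) : ℝ × ℝ := ((u.1 : ℝ), (u.2 : ℝ))

/-- The cone `ℝ_{≥0} u + ℝ_{≥0} w` spanned by two integer vectors. -/
def coneOf (u w : ℤ × ℤ) : Set (ℝ × ℝ) :=
  {x | ∃ a b : ℝ, 0 ≤ a ∧ 0 ≤ b ∧ x = a • toR2 u + b • toR2 w}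

/-- Complete fan data of length `d`: a cyclic sequence of primitive integer vectors with
`det(v_i, v_{i+1}) ≥ 1` whose successive cones cover `ℝ²` and have pairwise disjoint
interiors. -/
def IsCompleteFanData (d : ℕ) (v : ZMod d → ℤ × ℤ) : Prop :=
  3 ≤ d ∧
  (∀ i, Int.gcd (v i).1 (v i).2 = 1) ∧
  (∀ i, 1 ≤ detZ (v i) (v (i + 1))) ∧
  (⋃ i, coneOf (v i) (v (i + 1))) = Set.univ ∧
  ∀ i j, i ≠ j →
    interior (coneOf (v i) (v (i + 1))) ∩ interior (coneOf (v j) (v (j + 1))) = ∅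

/-- `f(i) = det(v_{i−1}, v_i) + det(v_i, v_{i+1}) + det(v_{i+1}, v_{i−1})`. -/
def fanF (d : ℕ) (v : ZMod d → ℤ × ℤ) (i : ZMod d) : ℤ :=
  detZ (v (i - 1)) (v i) + detZ (v i) (v (i + 1)) + detZ (v (i + 1)) (v (i - 1))

/-- LDP fan data: complete fan data with `f(i) ≥ 1` for all `i`. -/
def IsLDPFanData (d : ℕ) (v : ZMod d → ℤ × ℤ) : Prop :=
  IsCompleteFanData d v ∧ ∀ i, 1 ≤ fanF d v i

/-- The number of singular cones, i.e. indices `i` with `det(v_i, v_{i+1}) ≥ 2`. -/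
noncomputable def numSingular (d : ℕ) (v : ZMod d → ℤ × ℤ) : ℕ :=
  {i : ZMod d | 2 ≤ detZ (v i) (v (i + 1))}.ncard

/-- Equivalence of fan data: some `GL(2, ℤ)` matrix maps the vector set of one
bijectively onto the vector set of the other. -/
def FanEquiv {d₁ d₂ : ℕ} (v : ZMod d₁ → ℤ × ℤ) (w : ZMod d₂ → ℤ × ℤ) : Prop :=
  ∃ M : Matrix (Fin 2) (Fin 2) ℤ, IsUnit M.det ∧
    (fun u : ℤ × ℤ => (M 0 0 * u.1 + M 0 1 * u.2, M 1 0 * u.1 + M 1 1 * u.2)) ''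
      Set.range v = Set.range w

/-- The cyclic sequence of length `d − 1` obtained by deleting the vector `v_k`:
it lists `v_{k+1}, v_{k+2}, …, v_{k+d−1}`. -/
def deleteAt {d : ℕ} (v : ZMod d → ℤ × ℤ) (k : ZMod d) : ZMod (d - 1) → ℤ × ℤ :=
  fun i => v (k + 1 + (i.val : ZMod d))

/-- The cyclic sequence of length `d + 1` obtained by inserting `v_k + v_{k+1}`
between `v_k` and `v_{k+1}`. -/
def insertAt {d : ℕ} (v : ZMod d → ℤ × ℤ) (k : ZMod d) : ZMod (d + 1) → ℤ × ℤ :=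
  fun i =>
    if i.val ≤ k.val then v ((i.val : ℕ) : ZMod d)
    else if i.val = k.val + 1 then v k + v (k + 1)
    else v ((i.val - 1 : ℕ) : ZMod d)

/-- The data `(1,0), (0,1), (−p,−q)`. -/
def data3 (p q : ℤ) : ZMod 3 → ℤ × ℤ := fun i =>
  if i = 0 then (1, 0) else if i = 1 then (0, 1) else (-p, -q)

/-- The data `(1,0), (0,1), (−1,p), (q,r)`. -/
def data4 (p q r : ℤ) : ZMod 4 → ℤ × ℤ := fun i =>
  if i = 0 then (1, 0) else if i = 1 then (0, 1) else if i = 2 then (-1, p) else (q, r)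

/-- The data `(1,0), (0,1), (−1,p+1), (−1,p), (q,r)`. -/
def data5 (p q r : ℤ) : ZMod 5 → ℤ × ℤ := fun i =>
  if i = 0 then (1, 0) else if i = 1 then (0, 1) else if i = 2 then (-1, p + 1)
  else if i = 3 then (-1, p) else (q, r)

/-! ### Determinant algebra -/

lemma detZ_pl (p q u w : ℤ × ℤ) :
    detZ p q * detZ u w = detZ p u * detZ q w - detZ p w * detZ q u := by
  simp only [detZ]; ring

lemma detZ_anti (p q : ℤ × ℤ) : detZ p q = - detZ q p := by
  simp only [detZ]; ring

/-- Three-term recurrence along a unimodular chain. -/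
lemma det_rec (p q r z : ℤ × ℤ) (h1 : detZ p q = 1) (h2 : detZ q r = 1) :
    detZ r z = detZ p r * detZ q z - detZ p z := by
  have h := detZ_pl p q r z
  rw [h1, h2] at h
  linarith

lemma strict_of_prim (p q z : ℤ × ℤ) (h1 : detZ p q = 1) (hz : Int.gcd z.1 z.2 = 1)
    (he : detZ p z = detZ q z) : detZ q z = 1 ∨ detZ q z = -1 := by
  have hc : IsCoprime z.1 z.2 := Int.isCoprime_iff_gcd_eq_one.mpr hz
  have e1 : z.1 = detZ q z * (q.1 - p.1) := by
    have : z.1 * detZ p q = detZ p z * q.1 - detZ q z * p.1 := by simp only [detZ]; ring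
    rw [h1, he] at this; linarith
  have e2 : z.2 = detZ q z * (q.2 - p.2) := by
    have : z.2 * detZ p q = detZ p z * q.2 - detZ q z * p.2 := by simp only [detZ]; ring
    rw [h1, he] at this; linarith
  exact Int.isUnit_iff.mp (hc.isUnit_of_dvd' ⟨_, e1⟩ ⟨_, e2⟩)

/-! ### Chain arithmetic -/

/-- Values `det(v_i, z)` along the first three vertices of a chain. -/
lemma d2_pos (a d0 d1 d2 : ℤ) (ha : a ≤ 1) (h01 : d0 < d1) (h12 : d1 ≤ d2)
    (e2 : d2 = a * d1 - d0) : 1 ≤ d2 := by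
  by_cases h : d1 ≤ 0
  · nlinarith [mul_nonneg (sub_nonneg.mpr ha) (neg_nonneg.mpr h)]
  · omega

lemma no_four (a c d0 d1 d2 d3 d4 : ℤ) (ha : a ≤ 1) (hc : c ≤ 1)
    (h01 : d0 < d1) (h12 : d1 ≤ d2) (h23 : d2 ≤ d3) (h34 : d3 ≤ d4)
    (e2 : d2 = a * d1 - d0) (e4 : d4 = c * d3 - d2) : False := by
  have h2 := d2_pos a d0 d1 d2 ha h01 h12 e2
  nlinarith [mul_nonneg (sub_nonneg.mpr hc) (by linarith : 0 ≤ d3)]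

lemma three_arith (a b d0 d1 d2 d3 : ℤ) (ha : a ≤ 1) (hb : b ≤ 1)
    (h01 : d0 < d1) (h12 : d1 ≤ d2) (h23 : d2 ≤ d3)
    (e2 : d2 = a * d1 - d0) (e3 : d3 = b * d2 - d1) : a = 1 ∨ b = 1 := by
  have h2 := d2_pos a d0 d1 d2 ha h01 h12 e2
  by_contra! hne
  have ha' : a ≤ 0 := by have := hne.1; omega
  have hb' : b ≤ 0 := by have := hne.2; omega
  have h3 : d3 ≤ - d1 := by nlinarith
  nlinarith [mul_nonneg (neg_nonneg.mpr ha') (by linarith : 0 ≤ -d1)]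

/-! ### Two nonempty chains are impossible -/

lemma L11 (p q u w : ℤ × ℤ) (h1 : detZ p q = 1) (h2 : detZ u w = 1)
    (hqu : 2 ≤ detZ q u) (hwp : 2 ≤ detZ w p)
    (m1 : detZ p u ≤ detZ q u) (m2 : detZ p w ≤ detZ q w)
    (m3 : detZ u p ≤ detZ w p) (m4 : detZ u q ≤ detZ w q) : False := by
  have h := detZ_pl p q u w
  rw [detZ_anti u p] at m3
  rw [detZ_anti u q, detZ_anti w q] at m4
  rw [h1, h2, detZ_anti p w] at h
  rw [detZ_anti p w] at m2
  generalize detZ q u = P at *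
  generalize detZ w p = T at *
  generalize detZ p u = x at *
  generalize detZ q w = y at *
  have hP : 0 ≤ P - x := by linarith
  have hT : 0 ≤ T + y := by linarith
  have hP' : 0 ≤ P - y := by linarith
  have hT' : 0 ≤ T + x := by linarith
  have key : ∀ x y : ℤ, 1 * 1 = x * y - -T * P → 0 ≤ P - x → 0 ≤ T + y → 0 < x → False := by
    intro x y h hP hT hx
    have hy : y < 0 := by
      by_contra! hy
      nlinarith [mul_nonneg hx.le hy, mul_le_mul hwp hqu (by norm_num) (by linarith)]
    have i1 : P * (T + y) + (-y) * (P - x) = 1 := by linarith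
    rcases hT.eq_or_lt with h0 | h0
    · rcases hP.eq_or_lt with h3 | h3
      · rw [← h0, ← h3] at i1; simp at i1
      · have : T = -y := by linarith
        nlinarith
    · nlinarith [mul_nonneg (by linarith : 0 ≤ -y) hP]
  rcases lt_trichotomy x 0 with hx | hx | hx
  · apply key y x (by linarith) hP' hT'
    by_contra! hy
    nlinarith [mul_nonneg (neg_nonneg.mpr hx.le) (neg_nonneg.mpr hy),
      mul_le_mul hwp hqu (by norm_num) (by linarith)]
  · subst hx; nlinarith
  · exact key x y h hP hT hx

lemma wedge (a al be ga : ℤ) (ha : a ≤ 0) (h1 : al ≤ be) (h2 : be ≤ ga)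
    (e : ga = a * be - al) : al ≤ 0 := by
  by_contra! h
  nlinarith

lemma L21 (p q r u w : ℤ × ℤ) (h1 : detZ p q = 1) (h2 : detZ q r = 1) (h3 : detZ p r ≤ 0)
    (h4 : detZ u w = 1) (hwp : 2 ≤ detZ w p)
    (m3 : detZ u p ≤ detZ w p) (m4 : detZ u q ≤ detZ w q) (m5 : detZ u r ≤ detZ w r) : False := by
  have ru := det_rec p q r u h1 h2
  have rw' := det_rec p q r w h1 h2
  have h := detZ_pl p q u w
  rw [detZ_anti u p, detZ_anti w p] at m3
  rw [detZ_anti u q, detZ_anti w q] at m4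
  rw [detZ_anti u r, detZ_anti w r] at m5
  rw [detZ_anti w p] at hwp
  rw [h1, h4] at h
  have e : detZ p u = detZ p w := by nlinarith
  rw [e] at h
  have hd : detZ p w ∣ 1 := ⟨detZ q w - detZ q u, by linarith⟩
  have := Int.isUnit_iff.mp (isUnit_of_dvd_one hd)
  omega

lemma L22 (p q r u s w : ℤ × ℤ) (h1 : detZ p q = 1) (h2 : detZ q r = 1) (h3 : detZ p r ≤ 0)
    (h4 : detZ u s = 1) (h5 : detZ s w = 1) (h6 : detZ u w ≤ 0) (hwp : 2 ≤ detZ w p)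
    (m : ∀ z, z = u ∨ z = s ∨ z = w → detZ p z ≤ detZ q z ∧ detZ q z ≤ detZ r z) : False := by
  have al : ∀ z, z = u ∨ z = s ∨ z = w → detZ p z ≤ 0 := fun z hz =>
    wedge _ _ _ _ h3 (m z hz).1 (m z hz).2 (det_rec p q r z h1 h2)
  have a1 := al u (by simp)
  have a2 := al s (by simp)
  have e := det_rec u s w p h4 h5
  rw [detZ_anti p u] at a1
  rw [detZ_anti p s] at a2
  nlinarith

/-- A unimodular chain, seen from a vertex `z` such that the cone `(z, w 0)` is singular. -/
lemma chain_lemma (w : ℕ → ℤ × ℤ) (m : ℕ) (hm : 1 ≤ m) (z : ℤ × ℤ)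
    (hz : Int.gcd z.1 z.2 = 1) (hzw : 2 ≤ detZ z (w 0))
    (h1 : ∀ t < m, detZ (w t) (w (t+1)) = 1)
    (h2 : ∀ t, t + 2 ≤ m → detZ (w t) (w (t+2)) ≤ 1)
    (h3 : ∀ t < m, detZ (w t) z ≤ detZ (w (t+1)) z) :
    m ≤ 3 ∧ (m = 3 → detZ (w 0) (w 2) = 1 ∨ detZ (w 1) (w 3) = 1) ∧
      (detZ (w 0) (w m) = 1 ∨ ∃ l, l ≤ m ∧ detZ (w 0) (w l) = 1 ∧ detZ (w l) (w m) = 1 ∧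
        detZ (w 0) (w m) ≤ 0) := by
  have hd0 : detZ (w 0) z ≤ -2 := by rw [detZ_anti]; linarith
  have h01 : detZ (w 0) z < detZ (w 1) z := by
    refine lt_of_le_of_ne (h3 0 (by omega)) fun he => ?_
    have := strict_of_prim (w 0) (w 1) z (h1 0 (by omega)) hz he
    omega
  have hm3 : m ≤ 3 := by
    by_contra! hm4
    exact no_four _ _ _ _ _ _ _ (h2 0 (by omega)) (h2 2 (by omega)) h01
      (h3 1 (by omega)) (h3 2 (by omega)) (h3 3 (by omega))
      (det_rec _ _ _ z (h1 0 (by omega)) (h1 1 (by omega)))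
      (det_rec _ _ _ z (h1 2 (by omega)) (h1 3 (by omega)))
  have key : m = 3 → detZ (w 0) (w 2) = 1 ∨ detZ (w 1) (w 3) = 1 := by
    intro hm'
    exact three_arith _ _ _ _ _ _ (h2 0 (by omega)) (h2 1 (by omega)) h01
      (h3 1 (by omega)) (h3 2 (by omega))
      (det_rec _ _ _ z (h1 0 (by omega)) (h1 1 (by omega)))
      (det_rec _ _ _ z (h1 1 (by omega)) (h1 2 (by omega)))
  refine ⟨hm3, key, ?_⟩
  obtain rfl | rfl | rfl : m = 1 ∨ m = 2 ∨ m = 3 := by omega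
  · exact Or.inl (h1 0 (by omega))
  · have h := h2 0 (by omega)
    simp only [zero_add] at h
    by_cases h' : detZ (w 0) (w 2) = 1
    · exact Or.inl h'
    · exact Or.inr ⟨1, by omega, h1 0 (by omega), h1 1 (by omega), by omega⟩
  · right
    have a1 := h2 0 (by omega)
    have b1 := h2 1 (by omega)
    have e := det_rec (w 1) (w 2) (w 3) (w 0) (h1 1 (by omega)) (h1 2 (by omega))
    have c1 := h1 0 (by omega)
    simp only [zero_add, Nat.reduceAdd] at a1 b1 c1
    rw [detZ_anti (w 3), detZ_anti (w 2), detZ_anti (w 1) (w 0), c1] at e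
    rcases key rfl with k | k
    · exact ⟨2, by omega, k, h1 2 (by omega), by rw [k] at e; linarith⟩
    · exact ⟨1, by omega, c1, k, by rw [k] at e; linarith⟩

lemma chain_mono (w : ℕ → ℤ × ℤ) (m : ℕ) (z : ℤ × ℤ)
    (h3 : ∀ t < m, detZ (w t) z ≤ detZ (w (t+1)) z) :
    ∀ b, b ≤ m → ∀ a, a ≤ b → detZ (w a) z ≤ detZ (w b) z := by
  intro b
  induction b with
  | zero => intro _ a ha; obtain rfl : a = 0 := by omega
            exact le_rfl
  | succ b ih =>
    intro hb a ha
    rcases ha.eq_or_lt with rfl | h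
    · exact le_rfl
    · exact (ih (by omega) a (by omega)).trans (h3 b (by omega))

lemma two_chains (w y : ℕ → ℤ × ℤ) (m n : ℕ) (hm : 1 ≤ m) (hn : 1 ≤ n)
    (gw : ∀ t ≤ m, Int.gcd (w t).1 (w t).2 = 1) (gy : ∀ t ≤ n, Int.gcd (y t).1 (y t).2 = 1)
    (hs1 : 2 ≤ detZ (y n) (w 0)) (hs2 : 2 ≤ detZ (w m) (y 0))
    (h1 : ∀ t < m, detZ (w t) (w (t+1)) = 1)
    (h2 : ∀ t, t + 2 ≤ m → detZ (w t) (w (t+2)) ≤ 1)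
    (h3 : ∀ t < m, ∀ s ≤ n, detZ (w t) (y s) ≤ detZ (w (t+1)) (y s))
    (k1 : ∀ t < n, detZ (y t) (y (t+1)) = 1)
    (k2 : ∀ t, t + 2 ≤ n → detZ (y t) (y (t+2)) ≤ 1)
    (k3 : ∀ t < n, ∀ s ≤ m, detZ (y t) (w s) ≤ detZ (y (t+1)) (w s)) : False := by
  have c1 := (chain_lemma w m hm (y n) (gy n le_rfl) hs1 h1 h2
    (fun t ht => h3 t ht n le_rfl)).2.2
  have c2 := (chain_lemma y n hn (w m) (gw m le_rfl) hs2 k1 k2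
    (fun t ht => k3 t ht m le_rfl)).2.2
  have M1 : ∀ s ≤ n, ∀ b ≤ m, ∀ a ≤ b, detZ (w a) (y s) ≤ detZ (w b) (y s) :=
    fun s hs b hb a ha => chain_mono w m (y s) (fun t ht => h3 t ht s hs) b hb a ha
  have M2 : ∀ s ≤ m, ∀ b ≤ n, ∀ a ≤ b, detZ (y a) (w s) ≤ detZ (y b) (w s) :=
    fun s hs b hb a ha => chain_mono y n (w s) (fun t ht => k3 t ht s hs) b hb a ha
  rcases c1 with c1 | ⟨l, hl, l1, l2, l3⟩ <;> rcases c2 with c2 | ⟨j, hj, j1, j2, j3⟩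
  · exact L11 (w 0) (w m) (y 0) (y n) c1 c2 hs2 hs1
      (M1 0 (by omega) m le_rfl 0 (by omega)) (M1 n le_rfl m le_rfl 0 (by omega))
      (M2 0 (by omega) n le_rfl 0 (by omega)) (M2 m le_rfl n le_rfl 0 (by omega))
  · exact L21 (y 0) (y j) (y n) (w 0) (w m) j1 j2 j3 c1 hs2
      (M1 0 (by omega) m le_rfl 0 (by omega)) (M1 j hj m le_rfl 0 (by omega))
      (M1 n le_rfl m le_rfl 0 (by omega))
  · exact L21 (w 0) (w l) (w m) (y 0) (y n) l1 l2 l3 c2 hs1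
      (M2 0 (by omega) n le_rfl 0 (by omega)) (M2 l hl n le_rfl 0 (by omega))
      (M2 m le_rfl n le_rfl 0 (by omega))
  · refine L22 (w 0) (w l) (w m) (y 0) (y j) (y n) l1 l2 l3 j1 j2 j3 hs1 ?_
    rintro z (rfl | rfl | rfl)
    · exact ⟨M1 0 (by omega) l hl 0 (by omega), M1 0 (by omega) m le_rfl l hl⟩
    · exact ⟨M1 j hj l hl 0 (by omega), M1 j hj m le_rfl l hl⟩
    · exact ⟨M1 n le_rfl l hl 0 (by omega), M1 n le_rfl m le_rfl l hl⟩

/-! ### Geometry of complete fans -/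

lemma mem_interior_cone (u w x : ℤ × ℤ) (hux : 0 < detZ u x) (hxw : 0 < detZ x w)
    (huw : 0 < detZ u w) : toR2 x ∈ interior (coneOf u w) := by
  have hD : (0 : ℝ) < (u.1 : ℝ) * w.2 - u.2 * w.1 := by
    have : (0 : ℝ) < ((detZ u w : ℤ) : ℝ) := by exact_mod_cast huw
    simpa [detZ] using this
  rw [mem_interior]
  refine ⟨{y : ℝ × ℝ | 0 < (u.1 : ℝ) * y.2 - u.2 * y.1 ∧ 0 < y.1 * (w.2 : ℝ) - y.2 * w.1},
    ?_, ?_, ?_⟩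
  · rintro ⟨y1, y2⟩ ⟨h1, h2⟩
    simp only at h1 h2
    refine ⟨(y1 * w.2 - y2 * w.1) / ((u.1 : ℝ) * w.2 - u.2 * w.1),
      ((u.1 : ℝ) * y2 - u.2 * y1) / ((u.1 : ℝ) * w.2 - u.2 * w.1), by positivity,
      by positivity, ?_⟩
    ext
    · simp only [toR2, Prod.smul_mk, Prod.mk_add_mk, smul_eq_mul]
      have hne := hD.ne'
      rw [div_mul_eq_mul_div, div_mul_eq_mul_div, ← add_div, eq_div_iff hne]
      ring
    · simp only [toR2, Prod.smul_mk, Prod.mk_add_mk, smul_eq_mul]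
      have hne := hD.ne'
      rw [div_mul_eq_mul_div, div_mul_eq_mul_div, ← add_div, eq_div_iff hne]
      ring
  · have c1 : Continuous fun y : ℝ × ℝ => (u.1 : ℝ) * y.2 - u.2 * y.1 := by fun_prop
    have c2 : Continuous fun y : ℝ × ℝ => y.1 * (w.2 : ℝ) - y.2 * w.1 := by fun_prop
    exact (isOpen_lt continuous_const c1).inter (isOpen_lt continuous_const c2)
  · constructor
    · have : (0 : ℝ) < ((detZ u x : ℤ) : ℝ) := by exact_mod_cast hux
      simpa [detZ, toR2] using this
    · have : (0 : ℝ) < ((detZ x w : ℤ) : ℝ) := by exact_mod_cast hxw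
      simpa [detZ, toR2] using this

/-- No integer vector lies in the open cones of two distinct indices. -/
lemma fan_unique {d : ℕ} {v : ZMod d → ℤ × ℤ} (h : IsCompleteFanData d v) (i j : ZMod d)
    (x : ℤ × ℤ) (h1 : 0 < detZ (v i) x) (h2 : 0 < detZ x (v (i + 1)))
    (h3 : 0 < detZ (v j) x) (h4 : 0 < detZ x (v (j + 1))) : i = j := by
  by_contra hij
  have hi := h.2.2.1 i
  have hj := h.2.2.1 j
  have m1 := mem_interior_cone _ _ x h1 h2 (by linarith)
  have m2 := mem_interior_cone _ _ x h3 h4 (by linarith)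
  have := h.2.2.2.2 i j hij
  exact (Set.eq_empty_iff_forall_notMem.mp this) _ ⟨m1, m2⟩

/-- The vector sequence crosses the line `det(ρ, ·) = 0` upwards at most once. -/
lemma cross_unique {d : ℕ} {v : ZMod d → ℤ × ℤ} (h : IsCompleteFanData d v) (i j : ZMod d)
    (ρ : ℤ × ℤ) (h1 : detZ ρ (v i) ≤ 0) (h2 : 0 < detZ ρ (v (i + 1)))
    (h3 : detZ ρ (v j) ≤ 0) (h4 : 0 < detZ ρ (v (j + 1))) : i = j := by
  -- the auxiliary direction orthogonal to `ρ`
  set y : ℤ × ℤ := (-ρ.2, ρ.1) with hy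
  have hρy : 0 < detZ ρ y := by
    have hne : ρ.1 ≠ 0 ∨ ρ.2 ≠ 0 := by
      by_contra! hc
      simp only [detZ, hc.1, hc.2] at h2
      omega
    simp only [detZ, hy]
    rcases hne with hne | hne
    · nlinarith [sq_nonneg ρ.2, sq_pos_of_ne_zero hne]
    · nlinarith [sq_nonneg ρ.1, sq_pos_of_ne_zero hne]
  have hi := h.2.2.1 i
  have hj := h.2.2.1 j
  set N : ℤ := 1 + |detZ (v i) y| + |detZ y (v (i+1))| + |detZ (v j) y| + |detZ y (v (j+1))|
    with hN
  have key : ∀ u w : ℤ × ℤ, detZ ρ u ≤ 0 → 0 < detZ ρ w → 1 ≤ detZ u w →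
      |detZ u y| < N → |detZ y w| < N →
      0 < detZ u (N * ρ.1 + y.1, N * ρ.2 + y.2) ∧
      0 < detZ (N * ρ.1 + y.1, N * ρ.2 + y.2) w := by
    intro u w hu hw huw hN1 hN2
    have e1 : detZ u (N * ρ.1 + y.1, N * ρ.2 + y.2) = - N * detZ ρ u + detZ u y := by
      simp only [detZ]; ring
    have e2 : detZ (N * ρ.1 + y.1, N * ρ.2 + y.2) w = N * detZ ρ w + detZ y w := by
      simp only [detZ]; ring
    have hN0 : 0 < N := lt_of_le_of_lt (abs_nonneg _) hN1
    rw [abs_lt] at hN1 hN2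
    rw [e1, e2]
    constructor
    · rcases hu.eq_or_lt with h0 | h0
      · rw [h0]
        have hp := detZ_pl u w ρ y
        rw [detZ_anti u ρ, h0, detZ_anti w ρ] at hp
        have : 0 < detZ u y * detZ ρ w := by nlinarith
        have := pos_of_mul_pos_left this hw.le
        linarith
      · nlinarith
    · nlinarith
  have a1 := abs_nonneg (detZ (v i) y)
  have a2 := abs_nonneg (detZ y (v (i+1)))
  have a3 := abs_nonneg (detZ (v j) y)
  have a4 := abs_nonneg (detZ y (v (j+1)))
  have k1 := key _ _ h1 h2 hi (by omega) (by omega)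
  have k2 := key _ _ h3 h4 hj (by omega) (by omega)
  exact fan_unique h i j _ k1.1 k1.2 k2.1 k2.2

lemma up_cross (g : ℕ → ℤ) (t : ℕ) (h0 : g 0 ≤ 0) (ht : 0 < g t) :
    ∃ s < t, g s ≤ 0 ∧ 0 < g (s + 1) := by
  induction t with
  | zero => omega
  | succ t ih =>
    by_cases h : 0 < g t
    · obtain ⟨s, hs, h'⟩ := ih h
      exact ⟨s, by omega, h'⟩
    · exact ⟨t, by omega, by omega, ht⟩

/-- Global convexity along a unimodular edge. -/
lemma convex_edge {d : ℕ} {v : ZMod d → ℤ × ℤ} (h : IsLDPFanData d v) (e j : ZMod d)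
    (he : detZ (v e) (v (e + 1)) = 1) (h1 : j ≠ e) (h2 : j ≠ e + 1) :
    detZ (v e) (v j) ≤ detZ (v (e + 1)) (v j) := by
  obtain ⟨hc, hf⟩ := h
  have hd := hc.1
  have : NeZero d := ⟨by omega⟩
  by_contra! hlt
  set ρ : ℤ × ℤ := ((v e).1 - (v (e+1)).1, (v e).2 - (v (e+1)).2) with hρ
  have L : ∀ x, detZ ρ x = detZ (v e) x - detZ (v (e+1)) x := by
    intro x; simp only [detZ, hρ]; ring
  have b0 : detZ ρ (v (e + 2)) ≤ 0 := by
    have := hf (e + 1)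
    simp only [fanF] at this
    rw [show e + 1 - 1 = e by ring, show e + 1 + 1 = e + 2 by ring, he,
      detZ_anti (v (e+2))] at this
    rw [L]; linarith
  have b1 : detZ ρ (v (e - 1)) ≤ 0 := by
    have := hf e
    simp only [fanF] at this
    rw [he, detZ_anti (v (e-1))] at this
    rw [L]; linarith
  have b2 : 0 < detZ ρ (v (e - 1 + 1)) := by
    rw [show e - 1 + 1 = e by ring, L, detZ_anti (v (e+1)), he]
    simp only [detZ]; ring_nf; norm_num
  set t := (j - (e + 2)).val with ht
  have htd : t < d := ZMod.val_lt _
  have htj : j = e + 2 + (t : ZMod d) := by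
    rw [ht, ZMod.natCast_zmod_val]; ring
  have hdc : (d : ZMod d) = 0 := ZMod.natCast_self d
  have t1 : t ≠ d - 2 := by
    intro hh
    apply h1
    rw [htj, hh, Nat.cast_sub (by omega), hdc]; push_cast; ring
  have t2 : t ≠ d - 1 := by
    intro hh
    apply h2
    rw [htj, hh, Nat.cast_sub (by omega), hdc]; push_cast; ring
  obtain ⟨s, hs, s1, s2⟩ := up_cross (fun t => detZ ρ (v (e + 2 + (t : ZMod d)))) t
    (by simpa using b0) (by simp only [← htj]; rw [L]; linarith)
  have hu := cross_unique hc (e + 2 + (s : ZMod d)) (e - 1) ρ s1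
    (by push_cast at s2; rw [add_assoc]; exact s2) b1 b2
  have : ((s : ℕ) : ZMod d) = ((d - 3 : ℕ) : ZMod d) := by
    rw [Nat.cast_sub (by omega), hdc]; push_cast
    linear_combination hu
  have h5 := congrArg ZMod.val this
  rw [ZMod.val_cast_of_lt (by omega), ZMod.val_cast_of_lt (by omega)] at h5
  omega

/-! ### The number of singular cones depends only on the vector set -/

/-- The singular consecutive pairs in a set of vectors. -/
def singPairs (S : Set (ℤ × ℤ)) : Set ((ℤ × ℤ) × (ℤ × ℤ)) :=
  {c | c.1 ∈ S ∧ c.2 ∈ S ∧ 2 ≤ detZ c.1 c.2 ∧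
    ∀ x ∈ S, ¬ (0 < detZ c.1 x ∧ 0 < detZ x c.2)}

lemma not_in_cone {d : ℕ} {v : ZMod d → ℤ × ℤ} (h : IsCompleteFanData d v) (i j : ZMod d) :
    ¬ (0 < detZ (v i) (v j) ∧ 0 < detZ (v j) (v (i + 1))) := by
  rintro ⟨h1, h2⟩
  have hj := h.2.2.1 j
  set N : ℤ := 1 + |detZ (v i) (v (j+1))| + |detZ (v (j+1)) (v (i+1))| with hN
  set x : ℤ × ℤ := (N * (v j).1 + (v (j+1)).1, N * (v j).2 + (v (j+1)).2) with hx
  have a1 := abs_nonneg (detZ (v i) (v (j+1)))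
  have a2 := abs_nonneg (detZ (v (j+1)) (v (i+1)))
  have a3 := neg_abs_le (detZ (v i) (v (j+1)))
  have a4 := neg_abs_le (detZ (v (j+1)) (v (i+1)))
  have e1 : detZ (v i) x = N * detZ (v i) (v j) + detZ (v i) (v (j+1)) := by
    simp only [detZ, hx]; ring
  have e2 : detZ x (v (i+1)) = N * detZ (v j) (v (i+1)) + detZ (v (j+1)) (v (i+1)) := by
    simp only [detZ, hx]; ring
  have e3 : detZ (v j) x = detZ (v j) (v (j+1)) := by simp only [detZ, hx]; ring
  have e4 : detZ x (v (j+1)) = N * detZ (v j) (v (j+1)) := by simp only [detZ, hx]; ring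
  have := fan_unique h i j x (by rw [e1]; nlinarith) (by rw [e2]; nlinarith)
    (by rw [e3]; linarith) (by rw [e4]; nlinarith)
  subst this
  simp only [detZ] at h1
  linarith [mul_comm (v i).1 (v i).2]

lemma prim_eq (u w p : ℤ × ℤ) (hu : Int.gcd u.1 u.2 = 1) (hw : Int.gcd w.1 w.2 = 1)
    (h0 : detZ u w = 0) (h1 : 0 < detZ p u) (h2 : 0 < detZ p w) : u = w := by
  obtain ⟨a, b, hab⟩ := Int.isCoprime_iff_gcd_eq_one.mpr hu
  obtain ⟨a', b', hab'⟩ := Int.isCoprime_iff_gcd_eq_one.mpr hw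
  simp only [detZ] at h0
  -- `w = c u`
  set c := a * w.1 + b * w.2 with hc
  have e1 : w.1 = c * u.1 := by rw [hc]; linear_combination (-w.1) * hab - b * h0
  have e2 : w.2 = c * u.2 := by rw [hc]; linear_combination (-w.2) * hab + a * h0
  have hcu : c ∣ 1 := ⟨a' * u.1 + b' * u.2, by rw [← hab', e1, e2]; ring⟩
  have e3 : detZ p w = c * detZ p u := by simp only [detZ, e1, e2]; ring
  rcases Int.isUnit_iff.mp (isUnit_of_dvd_one hcu) with h | h
  · ext
    · rw [e1, h, one_mul]
    · rw [e2, h, one_mul]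
  · rw [e3, h] at h2; linarith

lemma numSingular_eq {d : ℕ} {v : ZMod d → ℤ × ℤ} (h : IsCompleteFanData d v) :
    numSingular d v = (singPairs (Set.range v)).ncard := by
  have himg : singPairs (Set.range v) =
      (fun i => (v i, v (i + 1))) '' {i : ZMod d | 2 ≤ detZ (v i) (v (i + 1))} := by
    ext ⟨a, b⟩
    constructor
    · rintro ⟨⟨i, rfl⟩, ⟨j, rfl⟩, h1, h2⟩
      simp only at h1 h2
      have h3 := h.2.2.1 i
      have h4 := h2 (v (i+1)) ⟨_, rfl⟩
      have h5 := not_in_cone h i j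
      have h6 := detZ_anti (v j) (v (i+1))
      have h7 : detZ (v j) (v (i+1)) = 0 := by
        by_contra hne
        rcases lt_or_gt_of_ne hne with hh | hh
        · exact h4 ⟨by linarith, by linarith⟩
        · exact h5 ⟨by linarith, hh⟩
      have h8 := prim_eq _ _ (v i) (h.2.1 j) (h.2.1 (i+1)) h7 (by linarith) (by linarith)
      refine ⟨i, ?_, by simp only [h8]⟩
      simp only [Set.mem_ofPred_eq, ← h8]; exact h1
    · rintro ⟨i, hi, he⟩
      simp only [Prod.mk.injEq] at he
      obtain ⟨rfl, rfl⟩ := he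
      refine ⟨⟨i, rfl⟩, ⟨i+1, rfl⟩, hi, ?_⟩
      rintro x ⟨j, rfl⟩
      exact not_in_cone h i j
  rw [himg, Set.InjOn.ncard_image, numSingular]
  intro i hi j hj hij
  simp only [Prod.mk.injEq] at hij
  have h3 := h.2.2.1 i
  set x : ℤ × ℤ := v i + v (i+1) with hx
  have e1 : detZ (v i) x = detZ (v i) (v (i+1)) := by
    simp only [detZ, hx, Prod.fst_add, Prod.snd_add]; ring
  have e2 : detZ x (v (i+1)) = detZ (v i) (v (i+1)) := by
    simp only [detZ, hx, Prod.fst_add, Prod.snd_add]; ring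
  exact fan_unique h i j x (by linarith) (by linarith) (by rw [← hij.1]; linarith)
    (by rw [← hij.2]; linarith)

/-- The action of an integer matrix on integer vectors. -/
def actZ (M : Matrix (Fin 2) (Fin 2) ℤ) (u : ℤ × ℤ) : ℤ × ℤ :=
  (M 0 0 * u.1 + M 0 1 * u.2, M 1 0 * u.1 + M 1 1 * u.2)

lemma detZ_act (M : Matrix (Fin 2) (Fin 2) ℤ) (u w : ℤ × ℤ) :
    detZ (actZ M u) (actZ M w) = M.det * detZ u w := by
  simp only [detZ, actZ, Matrix.det_fin_two]; ring

lemma act_inj (M : Matrix (Fin 2) (Fin 2) ℤ) (hM : M.det ≠ 0) : Function.Injective (actZ M) := by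
  intro u w h
  have h1 := congrArg Prod.fst h
  have h2 := congrArg Prod.snd h
  simp only [actZ] at h1 h2
  rw [Matrix.det_fin_two] at hM
  ext
  · apply mul_left_cancel₀ hM
    linear_combination M 1 1 * h1 - M 0 1 * h2
  · apply mul_left_cancel₀ hM
    linear_combination M 0 0 * h2 - M 1 0 * h1

lemma singPairs_act (M : Matrix (Fin 2) (Fin 2) ℤ) (hM : IsUnit M.det) (S : Set (ℤ × ℤ)) :
    (singPairs (actZ M '' S)).ncard = (singPairs S).ncard := by
  have hM0 : M.det ≠ 0 := hM.ne_zero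
  have inj := act_inj M hM0
  rcases Int.isUnit_iff.mp hM with h | h
  · have : singPairs (actZ M '' S) = (fun c => (actZ M c.1, actZ M c.2)) '' singPairs S := by
      ext ⟨a, b⟩
      constructor
      · rintro ⟨⟨a, ha, rfl⟩, ⟨b, hb, rfl⟩, h1, h2⟩
        refine ⟨(a, b), ⟨ha, hb, ?_, ?_⟩, rfl⟩
        · simpa [detZ_act, h] using h1
        · intro x hx
          simpa [detZ_act, h] using h2 _ ⟨x, hx, rfl⟩
      · rintro ⟨⟨a, b⟩, ⟨ha, hb, h1, h2⟩, he⟩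
        rw [← he]
        refine ⟨⟨a, ha, rfl⟩, ⟨b, hb, rfl⟩, by simpa [detZ_act, h] using h1, ?_⟩
        rintro _ ⟨x, hx, rfl⟩
        simpa [detZ_act, h] using h2 x hx
    rw [this, Set.ncard_image_of_injective]
    rintro ⟨a, b⟩ ⟨a', b'⟩ hh
    simp only [Prod.mk.injEq] at hh
    rw [inj hh.1, inj hh.2]
  · have key : ∀ x y, detZ (actZ M x) (actZ M y) = detZ y x := by
      intro x y; rw [detZ_act, h, detZ_anti x y]; ring
    have : singPairs (actZ M '' S) = (fun c => (actZ M c.2, actZ M c.1)) '' singPairs S := by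
      ext ⟨a, b⟩
      constructor
      · rintro ⟨⟨a, ha, rfl⟩, ⟨b, hb, rfl⟩, h1, h2⟩
        refine ⟨(b, a), ⟨hb, ha, ?_, ?_⟩, rfl⟩
        · simpa only [key] using h1
        · intro x hx hh
          have := h2 _ ⟨x, hx, rfl⟩
          simp only [key] at this
          exact this ⟨hh.2, hh.1⟩
      · rintro ⟨⟨a, b⟩, ⟨ha, hb, h1, h2⟩, he⟩
        rw [← he]
        refine ⟨⟨b, hb, rfl⟩, ⟨a, ha, rfl⟩, by simpa only [key] using h1, ?_⟩
        rintro _ ⟨x, hx, rfl⟩ hh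
        simp only [key] at hh
        exact h2 x hx ⟨hh.2, hh.1⟩
    rw [this, Set.ncard_image_of_injective]
    rintro ⟨a, b⟩ ⟨a', b'⟩ hh
    simp only [Prod.mk.injEq] at hh
    rw [inj hh.1, inj hh.2]

lemma numSingular_of_equiv {d d' : ℕ} {v : ZMod d → ℤ × ℤ} {w : ZMod d' → ℤ × ℤ}
    (h : IsCompleteFanData d v) (he : FanEquiv v w) :
    numSingular d v = (singPairs (Set.range w)).ncard := by
  obtain ⟨M, hM, hr⟩ := he
  rw [numSingular_eq h, ← hr]
  exact (singPairs_act M hM _).symm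

lemma range3 (w : ZMod 3 → ℤ × ℤ) : Set.range w = {w 0, w 1, w 2} := by
  ext x
  simp only [Set.mem_range, Set.mem_insert_iff, Set.mem_singleton_iff]
  constructor
  · rintro ⟨i, rfl⟩
    have hi : ∀ i : ZMod 3, i = 0 ∨ i = 1 ∨ i = 2 := by decide
    rcases hi i with rfl | rfl | rfl <;> simp
  · rintro (h | h | h) <;> exact ⟨_, h.symm⟩

lemma range4 (w : ZMod 4 → ℤ × ℤ) : Set.range w = {w 0, w 1, w 2, w 3} := by
  ext x
  simp only [Set.mem_range, Set.mem_insert_iff, Set.mem_singleton_iff]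
  constructor
  · rintro ⟨i, rfl⟩
    have hi : ∀ i : ZMod 4, i = 0 ∨ i = 1 ∨ i = 2 ∨ i = 3 := by decide
    rcases hi i with rfl | rfl | rfl | rfl <;> simp
  · rintro (h | h | h | h) <;> exact ⟨_, h.symm⟩

lemma range5 (w : ZMod 5 → ℤ × ℤ) : Set.range w = {w 0, w 1, w 2, w 3, w 4} := by
  ext x
  simp only [Set.mem_range, Set.mem_insert_iff, Set.mem_singleton_iff]
  constructor
  · rintro ⟨i, rfl⟩
    have hi : ∀ i : ZMod 5, i = 0 ∨ i = 1 ∨ i = 2 ∨ i = 3 ∨ i = 4 := by decide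
    rcases hi i with rfl | rfl | rfl | rfl | rfl <;> simp
  · rintro (h | h | h | h | h) <;> exact ⟨_, h.symm⟩

lemma range_data3 (p q : ℤ) : Set.range (data3 p q) = {(1,0), (0,1), (-p,-q)} := by
  rw [range3]; rfl

lemma range_data4 (p q r : ℤ) :
    Set.range (data4 p q r) = {(1,0), (0,1), (-1,p), (q,r)} := by
  rw [range4]; rfl

lemma range_data5 (p q r : ℤ) :
    Set.range (data5 p q r) = {(1,0), (0,1), (-1,p+1), (-1,p), (q,r)} := by
  rw [range5]; rfl

/-! ### Counting for the model data -/

lemma count3 (p q : ℤ) (hp : 2 ≤ p) (hq : 2 ≤ q) :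
    (singPairs (Set.range (data3 p q))).ncard = 2 := by
  have : singPairs (Set.range (data3 p q)) =
      {(((0,1) : ℤ × ℤ), (-p,-q)), ((-p,-q), (1,0))} := by
    rw [range_data3]
    ext ⟨a, b⟩
    simp only [singPairs, Set.mem_ofPred_eq, Set.mem_insert_iff, Set.mem_singleton_iff,
      Prod.mk.injEq, forall_eq_or_imp, forall_eq]
    constructor
    · rintro ⟨rfl | rfl | rfl, rfl | rfl | rfl, h1, h2⟩ <;> simp only [detZ] at h1 <;>
        first | (exfalso; nlinarith) | simp
    · rintro (⟨rfl, rfl⟩ | ⟨rfl, rfl⟩) <;> simp only [detZ] <;>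
        refine ⟨by simp, by simp, by linarith, ?_, ?_, ?_⟩ <;> rintro ⟨y1, y2⟩ <;> nlinarith
  rw [this, Set.ncard_pair]
  simp
  omega

lemma count4 (p q r : ℤ) (hp : p ≤ 1) (h1 : r ≤ -p * q - 2) (h2 : r ≤ -2) :
    (singPairs (Set.range (data4 p q r))).ncard = 2 := by
  have : singPairs (Set.range (data4 p q r)) =
      {(((-1,p) : ℤ × ℤ), (q,r)), ((q,r), (1,0))} := by
    rw [range_data4]
    ext ⟨a, b⟩
    simp only [singPairs, Set.mem_ofPred_eq, Set.mem_insert_iff, Set.mem_singleton_iff,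
      Prod.mk.injEq, forall_eq_or_imp, forall_eq]
    constructor
    · rintro ⟨rfl | rfl | rfl | rfl, rfl | rfl | rfl | rfl, h3, x1, x2, x3, x4⟩ <;>
        simp only [detZ] at h3 x1 x2 x3 x4 <;>
        first
          | (exfalso; nlinarith)
          | (exfalso; apply x1; constructor <;> nlinarith)
          | (exfalso; apply x2; constructor <;> nlinarith)
          | (exfalso; apply x3; constructor <;> nlinarith)
          | (exfalso; apply x4; constructor <;> nlinarith)
          | simp
    · rintro (⟨rfl, rfl⟩ | ⟨rfl, rfl⟩) <;> simp only [detZ] <;>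
        refine ⟨by simp, by simp, by nlinarith, ?_, ?_, ?_, ?_⟩ <;> rintro ⟨y1, y2⟩ <;>
        nlinarith
  rw [this, Set.ncard_pair]
  simp
  omega

lemma count5 (p q r : ℤ) (hp : p ≤ 0) (h1 : 1 ≤ q) (h2 : q ≤ -r - 1) :
    (singPairs (Set.range (data5 p q r))).ncard = 2 := by
  have hpq : 0 ≤ (-p) * q := mul_nonneg (by omega) (by omega)
  have : singPairs (Set.range (data5 p q r)) =
      {(((-1,p) : ℤ × ℤ), (q,r)), ((q,r), (1,0))} := by
    rw [range_data5]
    ext ⟨a, b⟩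
    simp only [singPairs, Set.mem_ofPred_eq, Set.mem_insert_iff, Set.mem_singleton_iff,
      Prod.mk.injEq, forall_eq_or_imp, forall_eq]
    constructor
    · rintro ⟨rfl | rfl | rfl | rfl | rfl, rfl | rfl | rfl | rfl | rfl, h3, x1, x2, x3, x4, x5⟩ <;>
        simp only [detZ] at h3 x1 x2 x3 x4 x5 <;>
        first
          | (exfalso; linarith)
          | (exfalso; apply x1; constructor <;> linarith)
          | (exfalso; apply x2; constructor <;> linarith)
          | (exfalso; apply x3; constructor <;> linarith)
          | (exfalso; apply x4; constructor <;> linarith)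
          | (exfalso; apply x5; constructor <;> linarith)
          | simp
    · rintro (⟨rfl, rfl⟩ | ⟨rfl, rfl⟩) <;> simp only [detZ] <;>
        refine ⟨by simp, by simp, by linarith, ?_, ?_, ?_, ?_, ?_⟩ <;> rintro ⟨y1, y2⟩ <;>
        nlinarith
  rw [this, Set.ncard_pair]
  simp
  omega

/-! ### Normal forms -/

lemma act_basis (P Q : ℤ × ℤ) (ε : ℤ) (hε : ε * ε = 1) (h : detZ P Q = ε) :
    ∃ M : Matrix (Fin 2) (Fin 2) ℤ, IsUnit M.det ∧
      ∀ x, actZ M x = (ε * detZ x Q, ε * detZ P x) := by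
  refine ⟨!![ε * Q.2, -(ε * Q.1); -(ε * P.2), ε * P.1], ?_, ?_⟩
  · have : (!![ε * Q.2, -(ε * Q.1); -(ε * P.2), ε * P.1]).det = ε := by
      rw [Matrix.det_fin_two_of]
      simp only [detZ] at h
      linear_combination ε * ε * h + ε * hε
    rw [this]
    exact IsUnit.of_mul_eq_one _ hε
  · intro x
    simp only [actZ, detZ, Matrix.of_apply, Matrix.cons_val', Matrix.cons_val_zero,
      Matrix.cons_val_one, Matrix.cons_val_fin_one, Prod.mk.injEq]
    constructor <;> ring

lemma gcd_act (M : Matrix (Fin 2) (Fin 2) ℤ) (hM : IsUnit M.det) (x : ℤ × ℤ)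
    (hx : Int.gcd x.1 x.2 = 1) : Int.gcd (actZ M x).1 (actZ M x).2 = 1 := by
  obtain ⟨a, b, hab⟩ := Int.isCoprime_iff_gcd_eq_one.mpr hx
  obtain ⟨c, hc⟩ := hM.exists_left_inv
  rw [← Int.isCoprime_iff_gcd_eq_one]
  rw [Matrix.det_fin_two] at hc
  refine ⟨c * (a * M 1 1 - b * M 1 0), c * (b * M 0 0 - a * M 0 1), ?_⟩
  simp only [actZ]
  linear_combination (a * x.1 + b * x.2) * hc + hab

lemma detZ_self (p : ℤ × ℤ) : detZ p p = 0 := by simp only [detZ]; ring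

lemma range_shift {d : ℕ} (v : ZMod d → ℤ × ℤ) (i : ZMod d) :
    Set.range v = Set.range (fun t => v (i + t)) :=
  ((Equiv.addLeft i).surjective.range_comp v).symm

/-- The right-hand side of the classification. -/
def Goal (d : ℕ) (v : ZMod d → ℤ × ℤ) : Prop :=
  ((d = 3 ∧ ∃ p q : ℤ, 2 ≤ p ∧ 2 ≤ q ∧ Int.gcd p q = 1 ∧
          FanEquiv v (data3 p q)) ∨
       (d = 4 ∧ ∃ p q r : ℤ, p ≤ 1 ∧
          r ≤ min (min (-p * q - 2) (-2)) (min (-q - 1) (q - p * q - 1)) ∧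
          Int.gcd q r = 1 ∧ FanEquiv v (data4 p q r)) ∨
       (d = 5 ∧ ∃ p q r : ℤ, p ≤ 0 ∧ 1 ≤ q ∧ q ≤ -r - 1 ∧
          Int.gcd q r = 1 ∧ FanEquiv v (data5 p q r)))

lemma normal3 {v : ZMod 3 → ℤ × ℤ} (p0 p1 z : ℤ × ℤ) (hr : Set.range v = {p0, p1, z})
    (h01 : detZ p0 p1 = 1) (h1z : 2 ≤ detZ p1 z) (hz0 : 2 ≤ detZ z p0)
    (hz : Int.gcd z.1 z.2 = 1) : Goal 3 v := by
  obtain ⟨M, hM, hact⟩ := act_basis p0 p1 1 (by norm_num) h01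
  have e : actZ M z = (-detZ p1 z, -detZ z p0) := by
    rw [hact, detZ_anti z p1, detZ_anti p0 z]; simp
  have hg := gcd_act M hM z hz
  rw [e] at hg
  refine Or.inl ⟨rfl, _, _, h1z, hz0, by simpa using hg, M, hM, ?_⟩
  change actZ M '' Set.range v = _
  rw [hr, range_data3, Set.image_insert_eq, Set.image_insert_eq, Set.image_singleton, e, hact,
    hact, detZ_self, detZ_self, h01]
  simp

lemma normal4 {v : ZMod 4 → ℤ × ℤ} (p0 p1 p2 z : ℤ × ℤ) (hr : Set.range v = {p0, p1, p2, z})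
    (h01 : detZ p0 p1 = 1) (h12 : detZ p1 p2 = 1) (ha : detZ p0 p2 ≤ 1)
    (h2z : 2 ≤ detZ p2 z) (hz0 : 2 ≤ detZ z p0)
    (m0 : detZ p0 z ≤ detZ p1 z) (m1 : detZ p1 z ≤ detZ p2 z)
    (hz : Int.gcd z.1 z.2 = 1) : Goal 4 v := by
  obtain ⟨M, hM, hact⟩ := act_basis p0 p1 1 (by norm_num) h01
  have e : actZ M z = (-detZ p1 z, -detZ z p0) := by
    rw [hact, detZ_anti z p1, detZ_anti p0 z]; simp
  have e2 : actZ M p2 = (-1, detZ p0 p2) := by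
    rw [hact, detZ_anti p2 p1, h12]; simp
  have hg := gcd_act M hM z hz
  rw [e] at hg
  have s0 : detZ p0 z < detZ p1 z := by
    refine lt_of_le_of_ne m0 fun he => ?_
    have := strict_of_prim p0 p1 z h01 hz he
    rw [← he, detZ_anti p0 z] at this
    omega
  have s1 : detZ p1 z < detZ p2 z := by
    refine lt_of_le_of_ne m1 fun he => ?_
    have := strict_of_prim p1 p2 z h12 hz he
    omega
  have hrec := det_rec p0 p1 p2 z h01 h12
  rw [detZ_anti p0 z] at s0 hrec
  refine Or.inr (Or.inl ⟨rfl, detZ p0 p2, -detZ p1 z, -detZ z p0, ha, ?_, hg, M, hM, ?_⟩)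
  · refine le_min (le_min ?_ ?_) (le_min ?_ ?_) <;> linarith
  change actZ M '' Set.range v = _
  rw [hr, range_data4, Set.image_insert_eq, Set.image_insert_eq, Set.image_insert_eq,
    Set.image_singleton, e, e2, hact, hact, detZ_self, detZ_self, h01]
  simp

lemma normal5 {v : ZMod 5 → ℤ × ℤ} (p0 p1 p2 p3 z : ℤ × ℤ)
    (hr : Set.range v = {p0, p1, p2, p3, z})
    (h01 : detZ p0 p1 = 1) (h12 : detZ p1 p2 = 1) (h23 : detZ p2 p3 = 1)
    (ha : detZ p0 p2 ≤ 1) (hb : detZ p1 p3 ≤ 1) (hab : detZ p0 p2 = 1 ∨ detZ p1 p3 = 1)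
    (h3z : 2 ≤ detZ p3 z) (hz0 : 2 ≤ detZ z p0)
    (m0 : detZ p0 z ≤ detZ p1 z) (m1 : detZ p1 z ≤ detZ p2 z) (m2 : detZ p2 z ≤ detZ p3 z)
    (hz : Int.gcd z.1 z.2 = 1) : Goal 5 v := by
  have s0 : detZ p0 z < detZ p1 z := by
    refine lt_of_le_of_ne m0 fun he => ?_
    have := strict_of_prim p0 p1 z h01 hz he
    rw [← he, detZ_anti p0 z] at this
    omega
  have s2 : detZ p2 z < detZ p3 z := by
    refine lt_of_le_of_ne m2 fun he => ?_
    have := strict_of_prim p2 p3 z h23 hz he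
    omega
  have r2 := det_rec p0 p1 p2 z h01 h12
  have r3 := det_rec p1 p2 p3 z h12 h23
  have r30 := det_rec p1 p2 p3 p0 h12 h23
  rw [detZ_anti p3 p0, detZ_anti p2 p0, detZ_anti p1 p0, h01] at r30
  rcases hab with hab | hab
  · -- reflect: use the basis `p3, p2`
    have h32 : detZ p3 p2 = -1 := by rw [detZ_anti, h23]
    obtain ⟨M, hM, hact⟩ := act_basis p3 p2 (-1) (by norm_num) h32
    have e : actZ M z = (detZ p2 z, -detZ p3 z) := by
      rw [hact, detZ_anti z p2]; simp
    have e1 : actZ M p1 = (-1, detZ p1 p3 - 1 + 1) := by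
      rw [hact, detZ_anti p3 p1, h12]; simp
    have e0 : actZ M p0 = (-1, detZ p1 p3 - 1) := by
      rw [hact, hab, detZ_anti p3 p0]; simp only [Prod.mk.injEq]
      rw [hab] at r30
      constructor <;> linarith
    have hg := gcd_act M hM z hz
    rw [e] at hg
    refine Or.inr (Or.inr ⟨rfl, detZ p1 p3 - 1, detZ p2 z, -detZ p3 z, by linarith, ?_, ?_,
      hg, M, hM, ?_⟩)
    · rw [hab] at r2; linarith
    · linarith
    change actZ M '' Set.range v = _
    rw [hr, range_data5, Set.image_insert_eq, Set.image_insert_eq, Set.image_insert_eq,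
      Set.image_insert_eq, Set.image_singleton, e, e1, e0, hact, hact, detZ_self, detZ_self, h32]
    ext x
    simp only [Set.mem_insert_iff, Set.mem_singleton_iff]
    norm_num
    tauto
  · obtain ⟨M, hM, hact⟩ := act_basis p0 p1 1 (by norm_num) h01
    have e : actZ M z = (-detZ p1 z, -detZ z p0) := by
      rw [hact, detZ_anti z p1, detZ_anti p0 z]; simp
    have e2 : actZ M p2 = (-1, detZ p0 p2 - 1 + 1) := by
      rw [hact, detZ_anti p2 p1, h12]; simp
    have e3 : actZ M p3 = (-1, detZ p0 p2 - 1) := by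
      rw [hact, detZ_anti p3 p1, hab]; simp only [Prod.mk.injEq]
      rw [hab] at r30
      constructor <;> linarith
    have hg := gcd_act M hM z hz
    rw [e] at hg
    rw [detZ_anti p0 z] at s0
    refine Or.inr (Or.inr ⟨rfl, detZ p0 p2 - 1, -detZ p1 z, -detZ z p0, by linarith, ?_, ?_,
      hg, M, hM, ?_⟩)
    · rw [hab] at r3; linarith
    · linarith
    change actZ M '' Set.range v = _
    rw [hr, range_data5, Set.image_insert_eq, Set.image_insert_eq, Set.image_insert_eq,
      Set.image_insert_eq, Set.image_singleton, e, e2, e3, hact, hact, detZ_self, detZ_self, h01]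
    simp

/-! ### The forward direction -/

lemma forward_aux {d : ℕ} {v : ZMod d → ℤ × ℤ} (h : IsLDPFanData d v) (i : ZMod d) (k : ℕ)
    (hk1 : 1 ≤ k) (hk : k + 1 < d)
    (hs : ∀ e, 2 ≤ detZ (v e) (v (e + 1)) ↔ e = i ∨ e = i + 1 + (k : ZMod d)) : Goal d v := by
  have hc := h.1
  have hd := hc.1
  have : NeZero d := ⟨by omega⟩
  have hdc : (d : ZMod d) = 0 := ZMod.natCast_self d
  set u : ℕ → ℤ × ℤ := fun t => v (i + 1 + (t : ZMod d)) with hu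
  have inj : ∀ s t : ℕ, s < d → t < d →
      i + 1 + (s : ZMod d) = i + 1 + (t : ZMod d) → s = t := by
    intro s t hs ht hst
    have h5 := congrArg ZMod.val (add_left_cancel hst)
    rwa [ZMod.val_cast_of_lt hs, ZMod.val_cast_of_lt ht] at h5
  have hi : i = i + 1 + ((d - 1 : ℕ) : ZMod d) := by
    rw [Nat.cast_sub (by omega), hdc]; push_cast; ring
  have us : ∀ t : ℕ, u (t + 1) = v (i + 1 + (t : ZMod d) + 1) := by
    intro t; simp only [hu]; congr 1; push_cast; ring
  have g : ∀ t, Int.gcd (u t).1 (u t).2 = 1 := fun t => hc.2.1 _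
  have s1 : 2 ≤ detZ (u k) (u (k + 1)) := by
    rw [us]; exact (hs _).2 (Or.inr rfl)
  have s2 : 2 ≤ detZ (u (d - 1)) (u 0) := by
    have := (hs i).2 (Or.inl rfl)
    simp only [hu, ← hi]
    simpa using this
  have uni : ∀ t, t + 1 < d → t ≠ k → detZ (u t) (u (t + 1)) = 1 := by
    intro t ht htk
    have h1 := hc.2.2.1 (i + 1 + (t : ZMod d))
    have h2 : ¬ 2 ≤ detZ (v (i + 1 + (t : ZMod d))) (v (i + 1 + (t : ZMod d) + 1)) := by
      rw [hs]
      rintro (h3 | h3)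
      · have := inj t (d - 1) (by omega) (by omega) (h3.trans hi)
        omega
      · exact htk (inj t k (by omega) (by omega) h3)
    rw [us]
    change detZ (v (i + 1 + (t : ZMod d))) _ = 1
    omega
  have conv : ∀ t, t + 1 < d → t ≠ k → ∀ s < d, s ≠ t → s ≠ t + 1 →
      detZ (u t) (u s) ≤ detZ (u (t + 1)) (u s) := by
    intro t ht htk s hs' h1 h2
    have h3 := uni t ht htk
    rw [us] at h3 ⊢
    refine convex_edge h _ _ h3 ?_ ?_
    · intro h4; exact h1 (inj s t hs' (by omega) h4)
    · intro h4
      apply h2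
      apply inj s (t + 1) hs' ht
      rw [h4]; push_cast; ring
  have tri : ∀ t, t + 2 < d → t ≠ k → t + 1 ≠ k → detZ (u t) (u (t + 2)) ≤ 1 := by
    intro t ht h1 h2
    have := conv t (by omega) h1 (t + 2) ht (by omega) (by omega)
    rwa [uni (t + 1) ht h2] at this
  by_cases hn : k + 2 = d
  · -- a single chain
    have hkd : d - 1 = k + 1 := by omega
    rw [hkd] at s2
    have cl := chain_lemma u k hk1 (u (k + 1)) (g _) s2
      (fun t ht => uni t (by omega) (by omega))
      (fun t ht => tri t (by omega) (by omega) (by omega))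
      (fun t ht => conv t (by omega) (by omega) (k + 1) (by omega) (by omega) (by omega))
    have hr := range_shift v (i + 1)
    obtain rfl | rfl | rfl : k = 1 ∨ k = 2 ∨ k = 3 := by have := cl.1; omega
    · obtain rfl : d = 3 := by omega
      refine normal3 (u 0) (u 1) (u 2) ?_ (uni 0 (by omega) (by omega)) s1 s2 (g _)
      rw [hr, range3]; simp [hu]
    · obtain rfl : d = 4 := by omega
      refine normal4 (u 0) (u 1) (u 2) (u 3) ?_ (uni 0 (by omega) (by omega))
        (uni 1 (by omega) (by omega)) (tri 0 (by omega) (by omega) (by omega)) s1 s2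
        (conv 0 (by omega) (by omega) 3 (by omega) (by omega) (by omega))
        (conv 1 (by omega) (by omega) 3 (by omega) (by omega) (by omega)) (g _)
      rw [hr, range4]; simp [hu]
    · obtain rfl : d = 5 := by omega
      refine normal5 (u 0) (u 1) (u 2) (u 3) (u 4) ?_ (uni 0 (by omega) (by omega))
        (uni 1 (by omega) (by omega)) (uni 2 (by omega) (by omega))
        (tri 0 (by omega) (by omega) (by omega)) (tri 1 (by omega) (by omega) (by omega))
        (cl.2.1 rfl) s1 s2
        (conv 0 (by omega) (by omega) 4 (by omega) (by omega) (by omega))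
        (conv 1 (by omega) (by omega) 4 (by omega) (by omega) (by omega))
        (conv 2 (by omega) (by omega) 4 (by omega) (by omega) (by omega)) (g _)
      rw [hr, range5]; simp [hu]
  · -- two nonempty chains
    exfalso
    obtain ⟨n, hn'⟩ : ∃ n, d = k + 2 + n := ⟨d - (k + 2), by omega⟩
    refine two_chains u (fun t => u (k + 1 + t)) k n hk1 (by omega) (fun t _ => g t)
      (fun t _ => g _) ?_ s1
      (fun t ht => uni t (by omega) (by omega))
      (fun t ht => tri t (by omega) (by omega) (by omega))
      (fun t ht s hs => conv t (by omega) (by omega) _ (by omega) (by omega) (by omega))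
      (fun t ht => uni (k + 1 + t) (by omega) (by omega))
      (fun t ht => tri (k + 1 + t) (by omega) (by omega) (by omega))
      (fun t ht s hs => conv (k + 1 + t) (by omega) (by omega) s (by omega) (by omega) (by omega))
    have : d - 1 = k + 1 + n := by omega
    rwa [this] at s2

lemma forward {d : ℕ} {v : ZMod d → ℤ × ℤ} (h : IsLDPFanData d v)
    (hs : numSingular d v = 2) : Goal d v := by
  have hd := h.1.1
  have : NeZero d := ⟨by omega⟩
  have hdc : (d : ZMod d) = 0 := ZMod.natCast_self d
  obtain ⟨i, j, hij, hset⟩ := Set.ncard_eq_two.mp hs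
  have hsing : ∀ e, 2 ≤ detZ (v e) (v (e + 1)) ↔ e = i ∨ e = j := by
    intro e
    have : e ∈ {i : ZMod d | 2 ≤ detZ (v i) (v (i + 1))} ↔ e ∈ ({i, j} : Set (ZMod d)) := by
      rw [hset]
    simpa using this
  set k := (j - (i + 1)).val with hk
  have hkd : k < d := ZMod.val_lt _
  have hkj : j = i + 1 + (k : ZMod d) := by
    rw [hk, ZMod.natCast_zmod_val]; ring
  have k1 : k ≠ d - 1 := by
    intro hh
    apply hij
    rw [hkj, hh, Nat.cast_sub (by omega), hdc]; push_cast; ring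
  by_cases hk0 : k = 0
  · have hji : i = j + 1 + ((d - 2 : ℕ) : ZMod d) := by
      rw [hkj, hk0, Nat.cast_sub (by omega), hdc]; push_cast; ring
    refine forward_aux h j (d - 2) (by omega) (by omega) fun e => ?_
    rw [← hji, hsing e, or_comm]
  · refine forward_aux h i k (by omega) (by omega) fun e => ?_
    rw [← hkj, hsing e]

/-- Classification of toric log del Pezzo surfaces with exactly two singular points. -/
theorem classification_two_singular_points
    (d : ℕ) (v : ZMod d → ℤ × ℤ) (h : IsLDPFanData d v) :
    numSingular d v = 2 ↔
      ((d = 3 ∧ ∃ p q : ℤ, 2 ≤ p ∧ 2 ≤ q ∧ Int.gcd p q = 1 ∧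
          FanEquiv v (data3 p q)) ∨
       (d = 4 ∧ ∃ p q r : ℤ, p ≤ 1 ∧
          r ≤ min (min (-p * q - 2) (-2)) (min (-q - 1) (q - p * q - 1)) ∧
          Int.gcd q r = 1 ∧ FanEquiv v (data4 p q r)) ∨
       (d = 5 ∧ ∃ p q r : ℤ, p ≤ 0 ∧ 1 ≤ q ∧ q ≤ -r - 1 ∧
          Int.gcd q r = 1 ∧ FanEquiv v (data5 p q r))) := by
  refine ⟨fun hs => forward h hs, ?_⟩
  rintro (⟨_, p, q, hp, hq, _, he⟩ | ⟨_, p, q, r, hp, hr, _, he⟩ | ⟨_, p, q, r, hp, hq, hr, _, he⟩)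
  · rw [numSingular_of_equiv h.1 he, count3 p q hp hq]
  · rw [le_min_iff, le_min_iff, le_min_iff] at hr
    rw [numSingular_of_equiv h.1 he, count4 p q r hp hr.1.1 hr.1.2]
  · rw [numSingular_of_equiv h.1 he, count5 p q r hp hq hr]
end

section
/- If v_1, …, v_d is LDP fan data with exactly two singular cones, then d ≤ 5. Equivalently, a toric log del Pezzo surface with exactly two singular points has Picard number at most three. -/
/-- Three-term linear dependency used for interiors: a point with positive coordinates is interior. -/
theorem fan_mem_interior (u w : ℤ × ℤ) (hD : 1 ≤ detZ u w) (x : ℤ × ℤ)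
    (h1 : 0 < detZ u x) (h2 : 0 < detZ x w) : toR2 x ∈ interior (coneOf u w) := by
  have hDR : (0 : ℝ) < (u.1 : ℝ) * w.2 - u.2 * w.1 := by
    have : (0 : ℤ) < u.1 * w.2 - u.2 * w.1 := by unfold detZ at hD; omega
    exact_mod_cast this
  rw [mem_interior]
  refine ⟨{y : ℝ × ℝ | 0 < (u.1 : ℝ) * y.2 - u.2 * y.1} ∩
    {y : ℝ × ℝ | 0 < y.1 * (w.2 : ℝ) - y.2 * w.1}, ?_, ?_, ?_, ?_⟩
  · rintro y ⟨hy1, hy2⟩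
    simp only [Set.mem_ofPred_eq] at hy1 hy2
    refine ⟨(y.1 * (w.2 : ℝ) - y.2 * w.1) / ((u.1 : ℝ) * w.2 - u.2 * w.1),
      ((u.1 : ℝ) * y.2 - u.2 * y.1) / ((u.1 : ℝ) * w.2 - u.2 * w.1),
      by positivity, by positivity, ?_⟩
    have hne := hDR.ne'
    ext
    · simp only [toR2, Prod.fst_add, Prod.smul_fst, smul_eq_mul]
      rw [div_mul_eq_mul_div, div_mul_eq_mul_div, ← add_div, eq_div_iff hne]
      ring
    · simp only [toR2, Prod.snd_add, Prod.smul_snd, smul_eq_mul]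
      rw [div_mul_eq_mul_div, div_mul_eq_mul_div, ← add_div, eq_div_iff hne]
      ring
  · exact (isOpen_lt continuous_const (by fun_prop)).inter
      (isOpen_lt continuous_const (by fun_prop))
  · simp only [Set.mem_ofPred_eq, toR2]
    unfold detZ at h1
    exact_mod_cast h1
  · simp only [Set.mem_ofPred_eq, toR2]
    unfold detZ at h2
    exact_mod_cast h2

theorem fan_half_open {d : ℕ} {v : ZMod d → ℤ × ℤ} (h : IsCompleteFanData d v) (n j : ZMod d)
    (h1 : 0 ≤ detZ (v n) (v j)) (h2 : 0 < detZ (v j) (v (n + 1))) : j = n := by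
  by_contra hne
  obtain ⟨-, -, hD, -, hdis⟩ := h
  have hDn := hD n
  have hDj := hD j
  set N : ℤ := |detZ (v n) (v (j + 1))| + |detZ (v (j + 1)) (v (n + 1))| + 1 with hN
  have a1 := neg_abs_le (detZ (v n) (v (j + 1)))
  have a2 := neg_abs_le (detZ (v (j + 1)) (v (n + 1)))
  have a3 := abs_nonneg (detZ (v n) (v (j + 1)))
  have a4 := abs_nonneg (detZ (v (j + 1)) (v (n + 1)))
  have hNpos : 0 < N := by omega
  let z : ℤ × ℤ := (N * (v j).1 + (v (j + 1)).1, N * (v j).2 + (v (j + 1)).2)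
  have e1 : detZ (v n) z = N * detZ (v n) (v j) + detZ (v n) (v (j + 1)) := by
    simp only [detZ, z]; ring
  have e2 : detZ z (v (n + 1)) = N * detZ (v j) (v (n + 1)) + detZ (v (j + 1)) (v (n + 1)) := by
    simp only [detZ, z]; ring
  have e3 : detZ (v j) z = detZ (v j) (v (j + 1)) := by
    simp only [detZ, z]; ring
  have e4 : detZ z (v (j + 1)) = N * detZ (v j) (v (j + 1)) := by
    simp only [detZ, z]; ring
  have m2 : toR2 z ∈ interior (coneOf (v j) (v (j + 1))) := by
    apply fan_mem_interior _ _ hDj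
    · rw [e3]; omega
    · rw [e4]; exact mul_pos hNpos (by omega)
  have m1 : toR2 z ∈ interior (coneOf (v n) (v (n + 1))) := by
    apply fan_mem_interior _ _ hDn
    · rw [e1]
      rcases h1.lt_or_eq with h1 | h1
      · nlinarith
      · rw [← h1]
        have pl : detZ (v n) (v (j + 1)) * detZ (v j) (v (n + 1)) =
            detZ (v n) (v (n + 1)) * detZ (v j) (v (j + 1)) -
            detZ (v n) (v j) * detZ (v (n + 1)) (v (j + 1)) := by
          simp only [detZ]; ring
        rw [← h1] at pl
        have : 0 < detZ (v n) (v (j + 1)) * detZ (v j) (v (n + 1)) := by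
          rw [pl]; nlinarith
        have := pos_of_mul_pos_left this h2.le
        linarith
    · rw [e2]; nlinarith
  have : toR2 z ∈ (∅ : Set (ℝ × ℝ)) := by
    rw [← hdis j n hne]; exact ⟨m2, m1⟩
  exact this

theorem fan_closed {d : ℕ} {v : ZMod d → ℤ × ℤ} (h : IsCompleteFanData d v) (n j : ZMod d)
    (h1 : 0 ≤ detZ (v n) (v j)) (h2 : 0 ≤ detZ (v j) (v (n + 1))) : j = n ∨ j = n + 1 := by
  rcases h2.lt_or_eq with h2 | h2
  · exact Or.inl (fan_half_open h n j h1 h2)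
  · right
    have hD := h.2.2.1
    have hDn := hD n
    have hDn1 := hD (n + 1)
    have hDj := hD j
    have anti : detZ (v (n + 1)) (v j) = - detZ (v j) (v (n + 1)) := by simp only [detZ]; ring
    have h1' : 0 < detZ (v n) (v j) := by
      rcases h1.lt_or_eq with h1 | h1
      · exact h1
      · exfalso
        have : detZ (v n) (v (n + 1)) * detZ (v j) (v (j + 1)) =
           detZ (v n) (v j) * detZ (v (n + 1)) (v (j + 1))
            + detZ (v j) (v (n + 1)) * detZ (v n) (v (j + 1)) := by
          simp only [detZ]; ring
        rw [← h1, ← h2] at this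
        nlinarith
    apply fan_half_open h
    · omega
    · have pl : detZ (v n) (v (n + 1)) * detZ (v j) (v (n + 1 + 1)) =
          detZ (v n) (v j) * detZ (v (n + 1)) (v (n + 1 + 1)) +
          detZ (v j) (v (n + 1)) * detZ (v n) (v (n + 1 + 1)) := by
        simp only [detZ]; ring
      rw [← h2] at pl
      have : 0 < detZ (v n) (v (n + 1)) * detZ (v j) (v (n + 1 + 1)) := by
        rw [pl]; nlinarith
      exact pos_of_mul_pos_right this (by omega)

/-- The (scaled) supporting functional of the edge `u w`. -/
def edgeL (u w x : ℤ × ℤ) : ℤ := detZ x w + detZ u x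

theorem edgeL_concave (u w p q r : ℤ × ℤ) :
    detZ p q * edgeL u w r + detZ q r * edgeL u w p = detZ p r * edgeL u w q := by
  simp only [edgeL, detZ]; ring

theorem edgeL_plucker (u w p q x : ℤ × ℤ) :
    edgeL u w x * detZ p q = edgeL u w q * detZ p x - edgeL u w p * detZ q x := by
  simp only [edgeL, detZ]; ring

theorem fan_ahead {d : ℕ} {v : ZMod d → ℤ × ℤ} (h : IsLDPFanData d v) (i j : ZMod d)
    (hL : detZ (v i) (v (i + 1)) ≤ edgeL (v i) (v (i + 1)) (v j))
    (hc : 0 < detZ (v (i + 1)) (v j)) : False := by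
  have hD := h.1.2.2.1
  have key : ∀ n : ℕ, 0 < detZ (v (i + n + 1)) (v j) ∧
      0 < edgeL (v i) (v (i + 1)) (v (i + n + 1)) ∧
      edgeL (v i) (v (i + 1)) (v (i + n + 1)) + n ≤ detZ (v i) (v (i + 1)) ∧
      edgeL (v i) (v (i + 1)) (v (i + n + 1)) ≤ edgeL (v i) (v (i + 1)) (v (i + n)) := by
    intro n
    induction n with
    | zero =>
      have := hD i
      have e1 : edgeL (v i) (v (i + 1)) (v (i + 1)) = detZ (v i) (v (i + 1)) := by
        simp only [edgeL, detZ]; ring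
      have e2 : edgeL (v i) (v (i + 1)) (v i) = detZ (v i) (v (i + 1)) := by
        simp only [edgeL, detZ]; ring
      simp only [Nat.cast_zero, add_zero]
      rw [e1, e2]
      exact ⟨hc, by omega, by omega, le_refl _⟩
    | succ n ih =>
      obtain ⟨ic, ih0, ihn, ihl⟩ := ih
      have ek : i + ((n + 1 : ℕ) : ZMod d) = i + n + 1 := by push_cast; ring
      rw [ek]
      set k := i + (n : ZMod d) with hk
      have hf := h.2 (k + 1)
      unfold fanF at hf
      rw [add_sub_cancel_right] at hf
      have cc := edgeL_concave (v i) (v (i + 1)) (v k) (v (k + 1)) (v (k + 1 + 1))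
      have anti : detZ (v (k + 1 + 1)) (v k) = - detZ (v k) (v (k + 1 + 1)) := by
        simp only [detZ]; ring
      have d0 := hD k
      have d1 := hD (k + 1)
      have lt : edgeL (v i) (v (i + 1)) (v (k + 1 + 1)) < edgeL (v i) (v (i + 1)) (v (k + 1)) := by
        by_contra hcon
        push Not at hcon
        have p1 := mul_le_mul_of_nonneg_left hcon (show 0 ≤ detZ (v k) (v (k + 1)) by omega)
        have p2 := mul_le_mul_of_nonneg_left ihl
          (show 0 ≤ detZ (v (k + 1)) (v (k + 1 + 1)) by omega)
        rw [anti] at hf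
        nlinarith
      have pc : 0 < detZ (v (k + 1 + 1)) (v j) := by
        by_contra hcon
        push Not at hcon
        have anti2 : detZ (v j) (v (k + 1 + 1)) = - detZ (v (k + 1 + 1)) (v j) := by
          simp only [detZ]; ring
        rcases fan_closed h.1 (k + 1) j ic.le (by omega) with hj | hj
        · rw [hj] at ic
          simp only [detZ] at ic
          linarith
        · rw [hj] at hL
          omega
      have pl := edgeL_plucker (v i) (v (i + 1)) (v (k + 1)) (v (k + 1 + 1)) (v j)
      refine ⟨pc, ?_, ?_, lt.le⟩
      · have dd := hD i
        have q1 : 0 < edgeL (v i) (v (i + 1)) (v j) * detZ (v (k + 1)) (v (k + 1 + 1)) :=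
          mul_pos (by omega) (by omega)
        have q2 := mul_pos ih0 pc
        have q3 : 0 < edgeL (v i) (v (i + 1)) (v (k + 1 + 1)) * detZ (v (k + 1)) (v j) := by
          linarith
        exact pos_of_mul_pos_left q3 ic.le
      · push_cast; omega
  have := key (detZ (v i) (v (i + 1))).toNat
  omega

theorem fan_behind {d : ℕ} {v : ZMod d → ℤ × ℤ} (h : IsLDPFanData d v) (i j : ZMod d)
    (hL : detZ (v i) (v (i + 1)) ≤ edgeL (v i) (v (i + 1)) (v j))
    (hc : 0 < detZ (v j) (v i)) : False := by
  have hD := h.1.2.2.1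
  have key : ∀ n : ℕ, 0 < detZ (v j) (v (i - n)) ∧
      0 < edgeL (v i) (v (i + 1)) (v (i - n)) ∧
      edgeL (v i) (v (i + 1)) (v (i - n)) + n ≤ detZ (v i) (v (i + 1)) ∧
      edgeL (v i) (v (i + 1)) (v (i - n)) ≤ edgeL (v i) (v (i + 1)) (v (i - n + 1)) := by
    intro n
    induction n with
    | zero =>
      have := hD i
      have e1 : edgeL (v i) (v (i + 1)) (v (i + 1)) = detZ (v i) (v (i + 1)) := by
        simp only [edgeL, detZ]; ring
      have e2 : edgeL (v i) (v (i + 1)) (v i) = detZ (v i) (v (i + 1)) := by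
        simp only [edgeL, detZ]; ring
      simp only [Nat.cast_zero, sub_zero]
      rw [e1, e2]
      exact ⟨hc, by omega, by omega, le_refl _⟩
    | succ n ih =>
      obtain ⟨ic, ih0, ihn, ihl⟩ := ih
      obtain ⟨k, hk⟩ : ∃ k : ZMod d, k = i - (n : ZMod d) - 1 := ⟨_, rfl⟩
      have ek : i - ((n + 1 : ℕ) : ZMod d) = k := by rw [hk]; push_cast; ring
      have ek' : i - (n : ZMod d) = k + 1 := by rw [hk]; ring
      rw [ek]
      rw [ek'] at ic ih0 ihn ihl
      have hf := h.2 (k + 1)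
      unfold fanF at hf
      rw [add_sub_cancel_right] at hf
      have cc := edgeL_concave (v i) (v (i + 1)) (v k) (v (k + 1)) (v (k + 1 + 1))
      have anti : detZ (v (k + 1 + 1)) (v k) = - detZ (v k) (v (k + 1 + 1)) := by
        simp only [detZ]; ring
      have d0 := hD k
      have d1 := hD (k + 1)
      have lt : edgeL (v i) (v (i + 1)) (v k) < edgeL (v i) (v (i + 1)) (v (k + 1)) := by
        by_contra hcon
        push Not at hcon
        have p1 := mul_le_mul_of_nonneg_left ihl (show 0 ≤ detZ (v k) (v (k + 1)) by omega)
        have p2 := mul_le_mul_of_nonneg_left hcon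
          (show 0 ≤ detZ (v (k + 1)) (v (k + 1 + 1)) by omega)
        rw [anti] at hf
        nlinarith
      have pc : 0 < detZ (v j) (v k) := by
        by_contra hcon
        push Not at hcon
        have anti2 : detZ (v k) (v j) = - detZ (v j) (v k) := by
          simp only [detZ]; ring
        rcases fan_closed h.1 k j (by omega) ic.le with hj | hj
        · rw [hj] at hL
          omega
        · rw [hj] at ic
          simp only [detZ] at ic
          linarith
      have pl := edgeL_plucker (v i) (v (i + 1)) (v k) (v (k + 1)) (v j)
      have anti3 : detZ (v k) (v j) = - detZ (v j) (v k) := by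
        simp only [detZ]; ring
      have anti4 : detZ (v (k + 1)) (v j) = - detZ (v j) (v (k + 1)) := by
        simp only [detZ]; ring
      rw [anti3, anti4] at pl
      refine ⟨pc, ?_, ?_, lt.le⟩
      · have dd := hD i
        have q1 : 0 < edgeL (v i) (v (i + 1)) (v j) * detZ (v k) (v (k + 1)) :=
          mul_pos (by omega) (by omega)
        have q2 := mul_pos ih0 pc
        have q3 : 0 < edgeL (v i) (v (i + 1)) (v k) * detZ (v j) (v (k + 1)) := by
          linarith
        exact pos_of_mul_pos_left q3 ic.le
      · push_cast; omega
  have := key (detZ (v i) (v (i + 1))).toNat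
  omega

/-- Every vertex off a smooth edge lies at height at most zero. -/
theorem fan_support {d : ℕ} {v : ZMod d → ℤ × ℤ} (h : IsLDPFanData d v) {i j : ZMod d}
    {i' : ZMod d} (hi : i' = i + 1)
    (hD : detZ (v i) (v i') = 1) (h1 : j ≠ i) (h2 : j ≠ i') :
    detZ (v j) (v i') + detZ (v i) (v j) ≤ 0 := by
  subst hi
  by_contra hcon
  push Not at hcon
  have hL : detZ (v i) (v (i + 1)) ≤ edgeL (v i) (v (i + 1)) (v j) := by
    unfold edgeL; omega
  by_cases c1 : 0 < detZ (v (i + 1)) (v j)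
  · exact fan_ahead h i j hL c1
  by_cases c2 : 0 < detZ (v j) (v i)
  · exact fan_behind h i j hL c2
  have a1 : detZ (v (i + 1)) (v j) = - detZ (v j) (v (i + 1)) := by simp only [detZ]; ring
  have a2 : detZ (v j) (v i) = - detZ (v i) (v j) := by simp only [detZ]; ring
  rcases fan_closed h.1 i j (by omega) (by omega) with hj | hj
  · exact h1 hj
  · exact h2 hj

theorem vec_coord {p q : ℤ × ℤ} (h : detZ p q = 1) (z : ℤ × ℤ) :
    ∃ x y : ℤ, z = x • p + y • q := by
  refine ⟨detZ z q, detZ p z, ?_⟩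
  unfold detZ at *
  ext
  · simp only [Prod.fst_add, Prod.smul_fst, smul_eq_mul]
    linear_combination (-z.1) * h
  · simp only [Prod.snd_add, Prod.smul_snd, smul_eq_mul]
    linear_combination (-z.2) * h

theorem detZ_coord {p q : ℤ × ℤ} (h : detZ p q = 1) (x y x' y' : ℤ) :
    detZ (x • p + y • q) (x' • p + y' • q) = x * y' - y * x' := by
  unfold detZ at *
  simp only [Prod.fst_add, Prod.smul_fst, Prod.snd_add, Prod.smul_snd, smul_eq_mul]
  linear_combination (x * y' - y * x') * h

theorem detZ_coord_l1 {p q : ℤ × ℤ} (h : detZ p q = 1) (x y : ℤ) :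
    detZ p (x • p + y • q) = y := by
  have := detZ_coord h 1 0 x y
  simp only [one_smul, zero_smul, add_zero] at this
  rw [this]; ring

theorem detZ_coord_l2 {p q : ℤ × ℤ} (h : detZ p q = 1) (x y : ℤ) :
    detZ q (x • p + y • q) = - x := by
  have := detZ_coord h 0 1 x y
  simp only [one_smul, zero_smul, zero_add] at this
  rw [this]; ring

theorem detZ_coord_r1 {p q : ℤ × ℤ} (h : detZ p q = 1) (x y : ℤ) :
    detZ (x • p + y • q) p = - y := by
  have := detZ_coord h x y 1 0
  simp only [one_smul, zero_smul, add_zero] at this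
  rw [this]; ring

theorem detZ_coord_r2 {p q : ℤ × ℤ} (h : detZ p q = 1) (x y : ℤ) :
    detZ (x • p + y • q) q = x := by
  have := detZ_coord h x y 0 1
  simp only [one_smul, zero_smul, zero_add] at this
  rw [this]; ring

/-- Arithmetic core of the case of four consecutive smooth cones. -/
theorem core_four (a b c x y : ℤ) (ha : a ≤ 1) (hc : c ≤ 1)
    (h1 : b * (c - 1) - 1 ≤ 0) (h0 : a * (b * (c - 1) - 1) - (c - 1) ≤ 0)
    (z01 : x + (a - 1) * y ≤ 0) (z12 : x + y ≤ 0) (z23 : y + (b - 1) * x ≤ 0)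
    (z34 : (b * (c - 1) - 1) * x + (c - 1) * y ≤ 0)
    (hD : 2 ≤ - x - a * y) (hx : x = 0 → y = 1 ∨ y = -1) : False := by
  have x0 : x = 0 → a = 1 → False := by
    intro e1 e2
    subst e1 e2
    rcases hx rfl with e | e <;> subst e <;> omega
  rcases hc.lt_or_eq with hc | hc
  · have ha1 : a = 1 := by
      by_contra hne
      have ha' : a ≤ 0 := by omega
      have : 0 ≤ a * (b * (c - 1) - 1) := mul_nonneg_of_nonpos_of_nonpos ha' h1
      omega
    refine x0 ?_ ha1
    subst ha1
    have hx0 : x ≤ 0 := by linarith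
    by_contra hne
    have hx1 : x ≤ -1 := by omega
    have p := mul_le_mul_of_nonneg_left z23 (show 0 ≤ 1 - c by omega)
    have : 0 ≤ (2 - c) * x := by nlinarith
    nlinarith
  · subst hc
    have hx0 : 0 ≤ x := by linarith
    rcases ha.lt_or_eq with ha | ha
    · have : 0 ≤ a * y := mul_nonneg_of_nonpos_of_nonpos (by omega) (by omega)
      omega
    · refine x0 ?_ ha
      subst ha
      linarith

theorem chain_four (w0 w1 w2 w3 w4 z : ℤ × ℤ)
    (d01 : detZ w0 w1 = 1) (d12 : detZ w1 w2 = 1) (d23 : detZ w2 w3 = 1) (d34 : detZ w3 w4 = 1)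
    (s12 : detZ w0 w2 + detZ w1 w0 ≤ 0)
    (s340 : detZ w0 w4 + detZ w3 w0 ≤ 0) (s341 : detZ w1 w4 + detZ w3 w1 ≤ 0)
    (s342 : detZ w2 w4 + detZ w3 w2 ≤ 0) (s34z : detZ z w4 + detZ w3 z ≤ 0)
    (s01z : detZ z w1 + detZ w0 z ≤ 0) (s12z : detZ z w2 + detZ w1 z ≤ 0)
    (s23z : detZ z w3 + detZ w2 z ≤ 0) (hD : 2 ≤ detZ z w0)
    (hg : Int.gcd z.1 z.2 = 1) : False := by
  obtain ⟨a, a', rfl⟩ := vec_coord d12 w0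
  obtain ⟨b', b, rfl⟩ := vec_coord d12 w3
  obtain ⟨c, c', rfl⟩ := vec_coord d12 w4
  obtain ⟨x, y, rfl⟩ := vec_coord d12 z
  simp only [detZ_coord d12, detZ_coord_l1 d12, detZ_coord_l2 d12, detZ_coord_r1 d12,
    detZ_coord_r2 d12] at *
  obtain rfl : a' = -1 := by omega
  obtain rfl : b' = -1 := by omega
  obtain rfl : c' = -1 - b * c := by linarith
  apply core_four a b (-c) x y
  · linarith
  · linarith
  · linarith
  · linarith
  · linarith
  · linarith
  · linarith
  · linarith
  · linarith
  · rintro rfl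
    have hu : IsUnit y := by
      rw [isUnit_iff_dvd_one]
      have : y ∣ ((Int.gcd ((0 : ℤ) • w1 + y • w2).1 ((0 : ℤ) • w1 + y • w2).2 : ℕ) : ℤ) := by
        apply Int.dvd_coe_gcd
        · simp
        · simp
      rw [hg] at this
      simpa using this
    exact Int.isUnit_iff.mp hu

theorem chain_three (w0 w1 w2 w3 w4 w5 : ℤ × ℤ)
    (d01 : detZ w0 w1 = 1) (d12 : detZ w1 w2 = 1) (d23 : detZ w2 w3 = 1) (d45 : detZ w4 w5 = 1)
    (s120 : detZ w0 w2 + detZ w1 w0 ≤ 0) (s123 : detZ w3 w2 + detZ w1 w3 ≤ 0)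
    (s450 : detZ w0 w5 + detZ w4 w0 ≤ 0) (s451 : detZ w1 w5 + detZ w4 w1 ≤ 0)
    (s452 : detZ w2 w5 + detZ w4 w2 ≤ 0) (s453 : detZ w3 w5 + detZ w4 w3 ≤ 0)
    (hD : 2 ≤ detZ w3 w4) : False := by
  obtain ⟨a, a', rfl⟩ := vec_coord d12 w0
  obtain ⟨b', b, rfl⟩ := vec_coord d12 w3
  obtain ⟨x, y, rfl⟩ := vec_coord d12 w4
  obtain ⟨x', y', rfl⟩ := vec_coord d12 w5
  simp only [detZ_coord d12, detZ_coord_l1 d12, detZ_coord_l2 d12, detZ_coord_r1 d12,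
    detZ_coord_r2 d12] at *
  obtain rfl : a' = -1 := by omega
  obtain rfl : b' = -1 := by omega
  obtain ⟨α, hα⟩ : ∃ α, α = y' - y := ⟨_, rfl⟩
  obtain ⟨β, hβ⟩ : ∃ β, β = x - x' := ⟨_, rfl⟩
  have hα0 : α ≤ 0 := by omega
  have hβ0 : β ≤ 0 := by omega
  have h0 : a * α ≤ β := by subst hα hβ; linarith
  have h3 : b * β ≤ α := by subst hα hβ; linarith
  have hL : α * x + β * y = 1 := by subst hα hβ; linarith
  have nz : α = 0 → β = 0 → False := by
    intro e1 e2; rw [e1, e2] at hL; omega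
  have ha : a = 1 := by
    by_contra hne
    have : 0 ≤ a * α := mul_nonneg_of_nonpos_of_nonpos (by omega) hα0
    have hb : β = 0 := by omega
    rw [hb] at h3
    exact nz (by omega) hb
  have hb : b = 1 := by
    by_contra hne
    have : 0 ≤ b * β := mul_nonneg_of_nonpos_of_nonpos (by omega) hβ0
    have hb : α = 0 := by omega
    rw [hb] at h0
    exact nz hb (by omega)
  subst ha hb
  have e : β = α := by omega
  rw [e] at hL
  have : α * (x + y) = 1 := by linarith
  have := Int.eq_one_or_neg_one_of_mul_eq_one (u := x + y) (v := α) (by linarith)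
  omega

theorem core_mul {A B u t : ℤ} (hA : 0 ≤ A) (hB : 0 ≤ B) (hu : 2 ≤ u) (ht : 0 ≤ t)
    (h : A * u + B * t = 1) : A = 0 ∧ B = 1 ∧ t = 1 := by
  have hBt := mul_nonneg hB ht
  have hA0 : A = 0 := by nlinarith
  subst hA0
  have h' : B * t = 1 := by linarith
  have h1 := Int.eq_one_or_neg_one_of_mul_eq_one h'
  have hB1 : B = 1 := by omega
  subst hB1
  omega

theorem chain_two (w0 w1 w2 w3 w4 w5 : ℤ × ℤ)
    (d01 : detZ w0 w1 = 1) (d12 : detZ w1 w2 = 1) (d34 : detZ w3 w4 = 1) (d45 : detZ w4 w5 = 1)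
    (s120 : detZ w0 w2 + detZ w1 w0 ≤ 0)
    (s340 : detZ w0 w4 + detZ w3 w0 ≤ 0) (s341 : detZ w1 w4 + detZ w3 w1 ≤ 0)
    (s342 : detZ w2 w4 + detZ w3 w2 ≤ 0) (s345 : detZ w5 w4 + detZ w3 w5 ≤ 0)
    (s450 : detZ w0 w5 + detZ w4 w0 ≤ 0) (s451 : detZ w1 w5 + detZ w4 w1 ≤ 0)
    (s452 : detZ w2 w5 + detZ w4 w2 ≤ 0)
    (s013 : detZ w3 w1 + detZ w0 w3 ≤ 0) (s123 : detZ w3 w2 + detZ w1 w3 ≤ 0)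
    (s015 : detZ w5 w1 + detZ w0 w5 ≤ 0) (s125 : detZ w5 w2 + detZ w1 w5 ≤ 0)
    (hD : 2 ≤ detZ w2 w3) (hD' : 2 ≤ detZ w5 w0) : False := by
  obtain ⟨a, a', rfl⟩ := vec_coord d12 w0
  obtain ⟨x3, y3, rfl⟩ := vec_coord d12 w3
  obtain ⟨x4, y4, rfl⟩ := vec_coord d12 w4
  obtain ⟨x5, y5, rfl⟩ := vec_coord d12 w5
  simp only [detZ_coord d12, detZ_coord_l1 d12, detZ_coord_l2 d12, detZ_coord_r1 d12,
    detZ_coord_r2 d12] at *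
  obtain rfl : a' = -1 := by omega
  obtain ⟨α, hα⟩ : ∃ α, α = y4 - y3 := ⟨_, rfl⟩
  obtain ⟨β, hβ⟩ : ∃ β, β = x3 - x4 := ⟨_, rfl⟩
  have hα0 : α ≤ 0 := by omega
  have hβ0 : β ≤ 0 := by omega
  have h0 : a * α ≤ β := by subst hα hβ; linarith
  have hL3 : α * x3 + β * y3 = 1 := by subst hα hβ; linarith
  have hL4 : α * x4 + β * y4 = 1 := by subst hα hβ; linarith
  rcases (show a ≤ 1 by linarith).lt_or_eq with ha | ha
  · have : 0 ≤ a * α := mul_nonneg_of_nonpos_of_nonpos (by omega) hα0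
    have hb : β = 0 := by omega
    rw [hb] at hL3
    have := Int.eq_one_or_neg_one_of_mul_eq_one (u := x3) (v := α) (by linarith)
    omega
  · subst ha
    obtain ⟨γ, hγ⟩ : ∃ γ, γ = y5 - y4 := ⟨_, rfl⟩
    obtain ⟨δ, hδ⟩ : ∃ δ, δ = x4 - x5 := ⟨_, rfl⟩
    have hM4 : γ * x4 + δ * y4 = 1 := by subst hγ hδ; linarith
    have hM5 : γ * x5 + δ * y5 = 1 := by subst hγ hδ; linarith
    obtain ⟨r1, r2, r3⟩ := core_mul (A := β - α) (B := -β) (u := -x3) (t := -x3 - y3)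
      (by omega) (by omega) (by omega) (by omega) (by linarith)
    obtain ⟨t1, t2, t3⟩ := core_mul (A := -δ) (B := δ - γ) (u := -x5 - y5) (t := -x5)
      (by omega) (by omega) (by omega) (by omega) (by linarith)
    have e1 : δ = 0 := by omega
    have e2 : x5 = -1 := by omega
    have e3 : x4 = -1 := by omega
    have e4 : α = -1 := by omega
    have e5 : β = -1 := by omega
    have e6 : x3 = -2 := by omega
    have e7 : y3 = 1 := by omega
    have e8 : y4 = 0 := by omega
    rw [e2, e3, e8] at d45
    have e9 : y5 = -1 := by omega
    rw [e2, e3, e6, e7, e8, e9] at s345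
    omega

theorem zmod_small_ne {d n : ℕ} (h0 : 0 < n) (hn : n < d) : (n : ZMod d) ≠ 0 := by
  rw [Ne, ZMod.natCast_eq_zero_iff]
  exact Nat.not_dvd_of_pos_of_lt h0 hn

theorem zmod_add_ne {d : ℕ} (i : ZMod d) {m n : ℕ} (hm : m < d) (hn : n < d) (h : m ≠ n) :
    i + (m : ZMod d) ≠ i + (n : ZMod d) := by
  intro e
  have e := add_left_cancel e
  rw [ZMod.natCast_eq_natCast_iff'] at e
  rw [Nat.mod_eq_of_lt hm, Nat.mod_eq_of_lt hn] at e
  exact h e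

/-- Main case analysis: `w n = v (s + 1 + n)`, smooth for `n < p`, singular at `n = p` and at
`n = d - 1`, smooth for `p < n < d - 1`. -/
theorem main_arc {d : ℕ} {v : ZMod d → ℤ × ℤ} (h : IsLDPFanData d v) (hd : 6 ≤ d)
    (i : ZMod d) (p : ℕ) (hp : p + 2 ≤ d) (hpq : d - 2 ≤ 2 * p)
    (hsm : ∀ n : ℕ, n < d - 1 → n ≠ p → detZ (v (i + (n : ZMod d))) (v (i + ((n + 1 : ℕ) : ZMod d))) = 1)
    (hs1 : 2 ≤ detZ (v (i + (p : ZMod d))) (v (i + ((p + 1 : ℕ) : ZMod d))))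
    (hs2 : 2 ≤ detZ (v (i + ((d - 1 : ℕ) : ZMod d))) (v (i + ((0 : ℕ) : ZMod d)))) : False := by
  have sup : ∀ n m : ℕ, n < d - 1 → n ≠ p → m < d → m ≠ n → m ≠ n + 1 →
      detZ (v (i + (m : ZMod d))) (v (i + ((n + 1 : ℕ) : ZMod d))) +
        detZ (v (i + (n : ZMod d))) (v (i + (m : ZMod d))) ≤ 0 := by
    intro n m hn hnp hm h1 h2
    apply fan_support h (by push_cast; ring) (hsm n hn hnp)
    · exact zmod_add_ne i hm (by omega) h1
    · exact zmod_add_ne i hm (by omega) h2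
  set w : ℕ → ℤ × ℤ := fun n => v (i + (n : ZMod d)) with hw
  change ∀ n : ℕ, n < d - 1 → n ≠ p → detZ (w n) (w (n + 1)) = 1 at hsm
  change 2 ≤ detZ (w p) (w (p + 1)) at hs1
  change 2 ≤ detZ (w (d - 1)) (w 0) at hs2
  change ∀ n m : ℕ, n < d - 1 → n ≠ p → m < d → m ≠ n → m ≠ n + 1 →
      detZ (w m) (w (n + 1)) + detZ (w n) (w m) ≤ 0 at sup
  have hprim : ∀ n, Int.gcd (w n).1 (w n).2 = 1 := fun n => h.1.2.1 _
  clear_value w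
  have hcases : 4 ≤ p ∨ p = 3 ∨ (p = 2 ∧ d = 6) := by omega
  rcases hcases with h4 | rfl | ⟨rfl, rfl⟩
  · exact chain_four (w 0) (w 1) (w 2) (w 3) (w 4) (w (d - 1))
      (hsm 0 (by omega) (by omega)) (hsm 1 (by omega) (by omega))
      (hsm 2 (by omega) (by omega)) (hsm 3 (by omega) (by omega))
      (sup 1 0 (by omega) (by omega) (by omega) (by omega) (by omega))
      (sup 3 0 (by omega) (by omega) (by omega) (by omega) (by omega))
      (sup 3 1 (by omega) (by omega) (by omega) (by omega) (by omega))
      (sup 3 2 (by omega) (by omega) (by omega) (by omega) (by omega))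
      (sup 3 (d - 1) (by omega) (by omega) (by omega) (by omega) (by omega))
      (sup 0 (d - 1) (by omega) (by omega) (by omega) (by omega) (by omega))
      (sup 1 (d - 1) (by omega) (by omega) (by omega) (by omega) (by omega))
      (sup 2 (d - 1) (by omega) (by omega) (by omega) (by omega) (by omega))
      hs2 (hprim _)
  · exact chain_three (w 0) (w 1) (w 2) (w 3) (w 4) (w 5)
      (hsm 0 (by omega) (by omega)) (hsm 1 (by omega) (by omega))
      (hsm 2 (by omega) (by omega)) (hsm 4 (by omega) (by omega))
      (sup 1 0 (by omega) (by omega) (by omega) (by omega) (by omega))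
      (sup 1 3 (by omega) (by omega) (by omega) (by omega) (by omega))
      (sup 4 0 (by omega) (by omega) (by omega) (by omega) (by omega))
      (sup 4 1 (by omega) (by omega) (by omega) (by omega) (by omega))
      (sup 4 2 (by omega) (by omega) (by omega) (by omega) (by omega))
      (sup 4 3 (by omega) (by omega) (by omega) (by omega) (by omega))
      hs1
  · exact chain_two (w 0) (w 1) (w 2) (w 3) (w 4) (w 5)
      (hsm 0 (by omega) (by omega)) (hsm 1 (by omega) (by omega))
      (hsm 3 (by omega) (by omega)) (hsm 4 (by omega) (by omega))
      (sup 1 0 (by omega) (by omega) (by omega) (by omega) (by omega))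
      (sup 3 0 (by omega) (by omega) (by omega) (by omega) (by omega))
      (sup 3 1 (by omega) (by omega) (by omega) (by omega) (by omega))
      (sup 3 2 (by omega) (by omega) (by omega) (by omega) (by omega))
      (sup 3 5 (by omega) (by omega) (by omega) (by omega) (by omega))
      (sup 4 0 (by omega) (by omega) (by omega) (by omega) (by omega))
      (sup 4 1 (by omega) (by omega) (by omega) (by omega) (by omega))
      (sup 4 2 (by omega) (by omega) (by omega) (by omega) (by omega))
      (sup 0 3 (by omega) (by omega) (by omega) (by omega) (by omega))
      (sup 1 3 (by omega) (by omega) (by omega) (by omega) (by omega))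
      (sup 0 5 (by omega) (by omega) (by omega) (by omega) (by omega))
      (sup 1 5 (by omega) (by omega) (by omega) (by omega) (by omega))
      hs1 hs2

theorem main_sing {d : ℕ} {v : ZMod d → ℤ × ℤ} (h : IsLDPFanData d v) (hd : 6 ≤ d)
    (s t : ZMod d) (p : ℕ) (ht : t = s + 1 + (p : ZMod d)) (hp : p + 2 ≤ d)
    (hpq : d - 2 ≤ 2 * p) (hS : ∀ k, 2 ≤ detZ (v k) (v (k + 1)) ↔ k = s ∨ k = t) : False := by
  have hd1 : ((d - 1 : ℕ) : ZMod d) = -1 := by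
    rw [Nat.cast_sub (by omega)]; simp
  apply main_arc h hd (s + 1) p hp hpq
  · intro n hn hnp
    have h1 := h.1.2.2.1 (s + 1 + (n : ZMod d))
    have h2 := hS (s + 1 + (n : ZMod d))
    have h3 : ¬ (s + 1 + (n : ZMod d) = s ∨ s + 1 + (n : ZMod d) = t) := by
      rintro (e | e)
      · apply zmod_add_ne (s + 1) (show n < d by omega) (show d - 1 < d by omega) (by omega)
        rw [e, hd1]; ring
      · rw [ht] at e
        exact zmod_add_ne (s + 1) (show n < d by omega) (show p < d by omega) hnp e
    have h4 := mt h2.mp h3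
    rw [show s + 1 + ((n + 1 : ℕ) : ZMod d) = s + 1 + (n : ZMod d) + 1 by push_cast; ring]
    omega
  · have := (hS t).mpr (Or.inr rfl)
    rw [ht] at this
    rw [show s + 1 + ((p + 1 : ℕ) : ZMod d) = s + 1 + (p : ZMod d) + 1 by push_cast; ring]
    exact this
  · have := (hS s).mpr (Or.inl rfl)
    rw [hd1, show s + 1 + (-1 : ZMod d) = s by ring]
    simpa using this

/-- A toric log del Pezzo surface with exactly two singular points has Picard
number at most three: LDP fan data with exactly two singular cones has length at most 5. -/
theorem two_singular_length_le_five (d : ℕ) (v : ZMod d → ℤ × ℤ)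
    (h : IsLDPFanData d v) (hs : numSingular d v = 2) : d ≤ 5 := by
  by_contra hcon
  have hd : 6 ≤ d := by omega
  haveI : NeZero d := ⟨by omega⟩
  unfold numSingular at hs
  obtain ⟨s, t, hst, hset⟩ := Set.ncard_eq_two.mp hs
  have hS : ∀ k, 2 ≤ detZ (v k) (v (k + 1)) ↔ k = s ∨ k = t := by
    intro k
    have : k ∈ {i : ZMod d | 2 ≤ detZ (v i) (v (i + 1))} ↔ k ∈ ({s, t} : Set (ZMod d)) := by
      rw [hset]
    simpa using this
  obtain ⟨p, hpd, hp⟩ : ∃ p : ℕ, p < d ∧ (p : ZMod d) = t - s - 1 :=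
    ⟨(t - s - 1).val, ZMod.val_lt _, ZMod.natCast_zmod_val _⟩
  have hp' : p ≠ d - 1 := by
    rintro rfl
    rw [Nat.cast_sub (by omega)] at hp
    apply hst
    simp only [ZMod.natCast_self, Nat.cast_one] at hp
    linear_combination hp
  by_cases hpq : d - 2 ≤ 2 * p
  · exact main_sing h hd s t p (by rw [hp]; ring) (by omega) hpq hS
  · refine main_sing h hd t s (d - 2 - p) ?_ (by omega) (by omega)
      (fun k => (hS k).trans or_comm)
    rw [Nat.cast_sub (by omega), Nat.cast_sub (by omega), hp]
    simp only [ZMod.natCast_self, Nat.cast_ofNat]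
    ring
end

section
/- Let v_1, …, v_d be LDP fan data with exactly three singular cones. Then one of the following holds: (1) d ≤ 4 (the associated surface has Picard number at most two); (2) d = 5 and there exist integers p, q, r, s, t with p ≤ 1, r ≤ min{−1, −pq−2, q−pq−1, −pq+qt−rs+ps+t−1}, t ≤ min{−2, −s−1, qt−rs+r−1}, 2 ≤ qt−rs, gcd(q, r) = gcd(s, t) = 1, such that the data is equivalent to the data (1,0), (0,1), (−1,p), (q,r), (s,t); (3) d = 6 and there exists an index k with v_k = v_{k−1} + v_{k+1} and det(v_{k−1}, v_k) = det(v_k, v_{k+1}) = 1 such that deleting v_k yields LDP fan data of length 5 with exactly three singular cones (i.e., X(Δ) is the blow-up of a toric log del Pezzo surface of Picard number three at one nonsingular torus-fixed point). -/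
/-- The data `(1,0), (0,1), (−1,p), (q,r), (s,t)`. -/
def data5' (p q r s t : ℤ) : ZMod 5 → ℤ × ℤ := fun i =>
  if i = 0 then (1, 0) else if i = 1 then (0, 1) else if i = 2 then (-1, p)
  else if i = 3 then (q, r) else (s, t)

/-- Integer form of LDP fan data: everything the combinatorial argument needs. -/
structure GoodFan (d : ℕ) (v : ZMod d → ℤ × ℤ) : Prop where
  prim : ∀ i, Int.gcd (v i).1 (v i).2 = 1
  det1 : ∀ i, 1 ≤ detZ (v i) (v (i + 1))
  cover : ∀ x : ℤ × ℤ, ∃ i, 0 ≤ detZ (v i) x ∧ 0 ≤ detZ x (v (i + 1))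
  disj : ∀ i j, ∀ x : ℤ × ℤ, 0 < detZ (v i) x → 0 < detZ x (v (i + 1)) →
    0 < detZ (v j) x → 0 < detZ x (v (j + 1)) → i = j
  fpos : ∀ i, 1 ≤ fanF d v i

/-- The real determinant. -/
def dR (x y : ℝ × ℝ) : ℝ := x.1 * y.2 - x.2 * y.1

lemma dR_toR2 (u w : ℤ × ℤ) : dR (toR2 u) (toR2 w) = (detZ u w : ℝ) := by
  simp [dR, toR2, detZ]

lemma mem_coneOf_iff {u w : ℤ × ℤ} (h : 1 ≤ detZ u w) (x : ℝ × ℝ) :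
    x ∈ coneOf u w ↔ 0 ≤ dR (toR2 u) x ∧ 0 ≤ dR x (toR2 w) := by
  have hD : (0 : ℝ) < dR (toR2 u) (toR2 w) := by
    rw [dR_toR2]; exact_mod_cast h
  constructor
  · rintro ⟨a, b, ha, hb, rfl⟩
    have h1 : dR (toR2 u) (a • toR2 u + b • toR2 w) = b * dR (toR2 u) (toR2 w) := by
      simp [dR]; ring
    have h2 : dR (a • toR2 u + b • toR2 w) (toR2 w) = a * dR (toR2 u) (toR2 w) := by
      simp [dR]; ring
    rw [h1, h2]
    exact ⟨by positivity, by positivity⟩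
  · rintro ⟨h1, h2⟩
    refine ⟨dR x (toR2 w) / dR (toR2 u) (toR2 w), dR (toR2 u) x / dR (toR2 u) (toR2 w),
      by positivity, by positivity, ?_⟩
    have hne := hD.ne'
    ext
    · simp only [Prod.fst_add, Prod.smul_fst, smul_eq_mul]
      field_simp
      simp only [dR]; ring
    · simp only [Prod.snd_add, Prod.smul_snd, smul_eq_mul]
      field_simp
      simp only [dR]; ring

lemma mem_interior_coneOf_iff {u w : ℤ × ℤ} (h : 1 ≤ detZ u w) (x : ℝ × ℝ) :
    x ∈ interior (coneOf u w) ↔ 0 < dR (toR2 u) x ∧ 0 < dR x (toR2 w) := by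
  have hD : (0 : ℝ) < dR (toR2 u) (toR2 w) := by
    rw [dR_toR2]; exact_mod_cast h
  constructor
  · intro hx
    have hx' : coneOf u w ∈ nhds x := mem_interior_iff_mem_nhds.1 hx
    have key : ∀ z : ℝ × ℝ, ∃ t : ℝ, 0 < t ∧ x + t • z ∈ coneOf u w := by
      intro z
      have hc : Filter.Tendsto (fun t : ℝ => x + t • z) (nhdsWithin 0 (Set.Ioi 0)) (nhds x) := by
        have : Continuous (fun t : ℝ => x + t • z) := by fun_prop
        have h0 := this.tendsto 0
        simp only [zero_smul, add_zero] at h0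
        exact h0.mono_left nhdsWithin_le_nhds
      have h1 := hc.eventually hx'
      obtain ⟨t, ht, ht'⟩ := (h1.and self_mem_nhdsWithin).exists
      exact ⟨t, ht', ht⟩
    constructor
    · obtain ⟨t, ht, hm⟩ := key (-toR2 w)
      have := ((mem_coneOf_iff h _).1 hm).1
      have e : dR (toR2 u) (x + t • -toR2 w) = dR (toR2 u) x - t * dR (toR2 u) (toR2 w) := by
        simp [dR]; ring
      rw [e] at this
      have := mul_pos ht hD
      linarith
    · obtain ⟨t, ht, hm⟩ := key (-toR2 u)
      have := ((mem_coneOf_iff h _).1 hm).2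
      have e : dR (x + t • -toR2 u) (toR2 w) = dR x (toR2 w) - t * dR (toR2 u) (toR2 w) := by
        simp [dR]; ring
      rw [e] at this
      have := mul_pos ht hD
      linarith
  · rintro ⟨h1, h2⟩
    rw [mem_interior]
    refine ⟨{y | 0 < dR (toR2 u) y} ∩ {y | 0 < dR y (toR2 w)}, ?_, ?_, h1, h2⟩
    · rintro y ⟨hy1, hy2⟩
      exact (mem_coneOf_iff h y).2 ⟨le_of_lt hy1, le_of_lt hy2⟩
    · apply IsOpen.inter
      · apply isOpen_lt continuous_const
        unfold dR; fun_prop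
      · apply isOpen_lt continuous_const
        unfold dR; fun_prop

lemma IsLDPFanData.goodFan {d : ℕ} {v : ZMod d → ℤ × ℤ} (h : IsLDPFanData d v) :
    GoodFan d v := by
  obtain ⟨⟨h3, hp, hd, hc, hi⟩, hf⟩ := h
  refine ⟨hp, hd, ?_, ?_, hf⟩
  · intro x
    have : toR2 x ∈ ⋃ i, coneOf (v i) (v (i + 1)) := by rw [hc]; trivial
    obtain ⟨i, hi⟩ := Set.mem_iUnion.1 this
    have := (mem_coneOf_iff (hd i) _).1 hi
    rw [dR_toR2, dR_toR2] at this
    exact ⟨i, by exact_mod_cast this.1, by exact_mod_cast this.2⟩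
  · intro i j x h1 h2 h3 h4
    by_contra hne
    have h5 : toR2 x ∈ interior (coneOf (v i) (v (i + 1))) := by
      rw [mem_interior_coneOf_iff (hd i), dR_toR2, dR_toR2]
      exact ⟨by exact_mod_cast h1, by exact_mod_cast h2⟩
    have h6 : toR2 x ∈ interior (coneOf (v j) (v (j + 1))) := by
      rw [mem_interior_coneOf_iff (hd j), dR_toR2, dR_toR2]
      exact ⟨by exact_mod_cast h3, by exact_mod_cast h4⟩
    have : toR2 x ∈ (∅ : Set (ℝ × ℝ)) := by rw [← hi i j hne]; exact ⟨h5, h6⟩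
    exact this

namespace GoodFan

variable {d : ℕ} {v : ZMod d → ℤ × ℤ}

/-- No ray of the fan lies in an open cone. -/
lemma not_open (h : GoodFan d v) (i k : ZMod d) (h1 : 0 < detZ (v i) (v k))
    (h2 : 0 < detZ (v k) (v (i + 1))) : False := by
  have hk := h.det1 k
  obtain ⟨N, hN⟩ : ∃ N : ℤ, N = 1 + |detZ (v i) (v (k + 1))| + |detZ (v (k + 1)) (v (i + 1))| :=
    ⟨_, rfl⟩
  have a1 := neg_abs_le (detZ (v i) (v (k + 1)))
  have a2 := neg_abs_le (detZ (v (k + 1)) (v (i + 1)))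
  have a3 := abs_nonneg (detZ (v i) (v (k + 1)))
  have a4 := abs_nonneg (detZ (v (k + 1)) (v (i + 1)))
  have e := h.disj i k (N * (v k).1 + (v (k + 1)).1, N * (v k).2 + (v (k + 1)).2) ?_ ?_ ?_ ?_
  · subst e
    simp only [detZ] at h1
    linarith
  · have : detZ (v i) (N * (v k).1 + (v (k + 1)).1, N * (v k).2 + (v (k + 1)).2)
      = N * detZ (v i) (v k) + detZ (v i) (v (k + 1)) := by simp only [detZ]; ring
    rw [this]; nlinarith
  · have : detZ (N * (v k).1 + (v (k + 1)).1, N * (v k).2 + (v (k + 1)).2) (v (i + 1))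
      = N * detZ (v k) (v (i + 1)) + detZ (v (k + 1)) (v (i + 1)) := by simp only [detZ]; ring
    rw [this]; nlinarith
  · have : detZ (v k) (N * (v k).1 + (v (k + 1)).1, N * (v k).2 + (v (k + 1)).2)
      = detZ (v k) (v (k + 1)) := by simp only [detZ]; ring
    rw [this]; linarith
  · have : detZ (N * (v k).1 + (v (k + 1)).1, N * (v k).2 + (v (k + 1)).2) (v (k + 1))
      = N * detZ (v k) (v (k + 1)) := by simp only [detZ]; ring
    rw [this]; nlinarith

lemma inj (h : GoodFan d v) {i k : ZMod d} (hik : v k = v i) : k = i := by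
  have hk := h.det1 k
  have hi := h.det1 i
  rw [hik] at hk
  obtain ⟨N, hN⟩ : ∃ N : ℤ, N = 1 + |detZ (v (i + 1)) (v (k + 1))| := ⟨_, rfl⟩
  have a2 := neg_abs_le (detZ (v (i + 1)) (v (k + 1)))
  have a4 := abs_nonneg (detZ (v (i + 1)) (v (k + 1)))
  have e1 : detZ (v i) (N * (v i).1 + (v (i + 1)).1, N * (v i).2 + (v (i + 1)).2)
      = detZ (v i) (v (i + 1)) := by simp only [detZ]; ring
  refine h.disj k i (N * (v i).1 + (v (i + 1)).1, N * (v i).2 + (v (i + 1)).2) ?_ ?_ ?_ ?_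
  · rw [hik, e1]; linarith
  · have : detZ (N * (v i).1 + (v (i + 1)).1, N * (v i).2 + (v (i + 1)).2) (v (k + 1))
      = N * detZ (v i) (v (k + 1)) + detZ (v (i + 1)) (v (k + 1)) := by simp only [detZ]; ring
    rw [this]; nlinarith
  · rw [e1]; linarith
  · have : detZ (N * (v i).1 + (v (i + 1)).1, N * (v i).2 + (v (i + 1)).2) (v (i + 1))
      = N * detZ (v i) (v (i + 1)) := by simp only [detZ]; ring
    rw [this]; nlinarith

/-- A primitive vector that is a multiple of an integer vector. -/
lemma prim_mul (h : GoodFan d v) (k : ZMod d) (n : ℤ) (y : ℤ × ℤ) (h1 : (v k).1 = n * y.1)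
    (h2 : (v k).2 = n * y.2) : n = 1 ∨ n = -1 := by
  have hp := h.prim k
  rw [h1, h2, Int.gcd_mul_left] at hp
  have := Nat.eq_one_of_mul_eq_one_right hp
  omega

/-- A linear functional that is nonpositive on all rays vanishes on all rays. -/
lemma functional (h : GoodFan d v) (c : ℤ × ℤ) (hc : ∀ k, detZ c (v k) ≤ 0) (k : ZMod d) :
    detZ c (v k) = 0 := by
  obtain ⟨i, h1, h2⟩ := h.cover (-(v k))
  have hd := h.det1 i
  have e : detZ (v i) (v (i + 1)) * detZ c (-(v k))
      = detZ (-(v k)) (v (i + 1)) * detZ c (v i) + detZ (v i) (-(v k)) * detZ c (v (i + 1)) := by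
    simp only [detZ, Prod.fst_neg, Prod.snd_neg]; ring
  have e2 : detZ c (-(v k)) = - detZ c (v k) := by
    simp only [detZ, Prod.fst_neg, Prod.snd_neg]; ring
  have := hc i
  have := hc (i + 1)
  have h0 := hc k
  rw [e2] at e
  have : detZ (v i) (v (i + 1)) * -detZ c (v k) ≤ 0 := by rw [e]; nlinarith
  nlinarith

/-- For a nonsingular cone, the functional equal to 1 on its two rays. -/
lemma edge (h : GoodFan d v) (i k : ZMod d) (hN : detZ (v i) (v (i + 1)) = 1)
    (hki : k ≠ i) (hki1 : k ≠ i + 1) :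
    detZ (v i - v (i + 1)) (v k) ≤ 0 ∧ (detZ (v i - v (i + 1)) (v k) = 0 →
      (k = i + 2 ∧ v (i + 1) = v i + v (i + 2)) ∨ (k = i - 1 ∧ v i = v (i - 1) + v (i + 1))) := by
  obtain ⟨X, hX⟩ : ∃ X, X = detZ (v k) (v (i + 1)) := ⟨_, rfl⟩
  obtain ⟨Y, hY⟩ : ∃ Y, Y = detZ (v i) (v k) := ⟨_, rfl⟩
  have hL : detZ (v i - v (i + 1)) (v k) = X + Y := by
    rw [hX, hY]; simp only [detZ, Prod.fst_sub, Prod.snd_sub]; ring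
  have k1 : (v k).1 = X * (v i).1 + Y * (v (i + 1)).1 := by
    rw [hX, hY]; simp only [detZ] at hN ⊢; linear_combination (-(v k).1) * hN
  have k2 : (v k).2 = X * (v i).2 + Y * (v (i + 1)).2 := by
    rw [hX, hY]; simp only [detZ] at hN ⊢; linear_combination (-(v k).2) * hN
  have i11 : i + 1 + 1 = i + 2 := by ring
  have i1m : i + 1 - 1 = i := by ring
  have im1 : i - 1 + 1 = i := by ring
  -- the next ray
  have fa := h.fpos (i + 1)
  have da := h.det1 (i + 1)
  simp only [fanF, i11, i1m] at fa da
  obtain ⟨a, ha⟩ : ∃ a, a = detZ (v (i + 1)) (v (i + 2)) := ⟨_, rfl⟩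
  obtain ⟨c, hc⟩ : ∃ c, c = detZ (v i) (v (i + 2)) := ⟨_, rfl⟩
  have hcc : detZ (v (i + 2)) (v i) = - c := by rw [hc]; simp only [detZ]; ring
  rw [hN, ← ha, hcc] at fa
  rw [← ha] at da
  -- the previous ray
  have fb := h.fpos i
  have db := h.det1 (i - 1)
  simp only [fanF, im1] at fb db
  obtain ⟨b, hb⟩ : ∃ b, b = detZ (v (i - 1)) (v i) := ⟨_, rfl⟩
  obtain ⟨e, he⟩ : ∃ e, e = detZ (v (i - 1)) (v (i + 1)) := ⟨_, rfl⟩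
  have hee : detZ (v (i + 1)) (v (i - 1)) = - e := by rw [he]; simp only [detZ]; ring
  rw [hN, ← hb, hee] at fb
  rw [← hb] at db
  have d1 : detZ (v (i + 1)) (v k) = - X := by rw [hX]; simp only [detZ]; ring
  have d2 : detZ (v k) (v (i + 2)) = X * c + Y * a := by
    rw [hc, ha]; simp only [detZ, k1, k2]; ring
  have d3 : detZ (v k) (v i) = - Y := by rw [hY]; simp only [detZ]; ring
  have d4 : detZ (v (i - 1)) (v k) = X * b + Y * e := by
    rw [hb, he]; simp only [detZ, k1, k2]; ring
  have n0 := h.not_open i k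
  have n1 := h.not_open (i + 1) k
  have n2 := h.not_open (i - 1) k
  rw [i11, d1, d2] at n1
  rw [im1, d3, d4] at n2
  rw [← hX, ← hY] at n0
  rw [hL]
  -- vectors with X + Y > 0
  have hle : X + Y ≤ 0 := by
    by_contra hpos
    push Not at hpos
    rcases lt_trichotomy X 0 with hx | hx | hx
    · exact n1 (by linarith) (by nlinarith)
    · rw [hx] at k1 k2
      simp only [zero_mul, zero_add] at k1 k2
      rcases h.prim_mul k Y (v (i + 1)) k1 k2 with h1 | h1
      · apply hki1
        apply h.inj
        ext
        · rw [k1, h1]; ring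
        · rw [k2, h1]; ring
      · omega
    · rcases lt_trichotomy Y 0 with hy | hy | hy
      · exact n2 (by nlinarith) (by linarith)
      · rw [hy] at k1 k2
        simp only [zero_mul, add_zero] at k1 k2
        rcases h.prim_mul k X (v i) k1 k2 with h1 | h1
        · apply hki
          apply h.inj
          ext
          · rw [k1, h1]; ring
          · rw [k2, h1]; ring
        · omega
      · exact n0 hy hx
  refine ⟨hle, fun h0 => ?_⟩
  have hYX : Y = - X := by linarith
  subst hYX
  rcases h.prim_mul k X (v i - v (i + 1)) (by rw [k1]; simp only [Prod.fst_sub]; ring)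
    (by rw [k2]; simp only [Prod.snd_sub]; ring) with h1 | h1
  · right
    rw [h1] at n2 k1 k2
    have hbe : e = b := by
      by_contra hne
      have : e < b := lt_of_le_of_ne (by linarith) hne
      exact n2 (by linarith) (by norm_num)
    have p1 : (v (i - 1)).1 = b * (v i - v (i + 1)).1 := by
      have : (v (i - 1)).1 = e * (v i).1 - b * (v (i + 1)).1 := by
        rw [he, hb]; simp only [detZ] at hN ⊢; linear_combination (-(v (i - 1)).1) * hN
      rw [this, hbe]; simp only [Prod.fst_sub]; ring
    have p2 : (v (i - 1)).2 = b * (v i - v (i + 1)).2 := by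
      have : (v (i - 1)).2 = e * (v i).2 - b * (v (i + 1)).2 := by
        rw [he, hb]; simp only [detZ] at hN ⊢; linear_combination (-(v (i - 1)).2) * hN
      rw [this, hbe]; simp only [Prod.snd_sub]; ring
    have hb1 : b = 1 := by
      rcases h.prim_mul (i - 1) b _ p1 p2 with h2 | h2 <;> omega
    rw [hb1] at p1 p2
    simp only [Prod.fst_sub, Prod.snd_sub] at p1 p2
    refine ⟨h.inj ?_, ?_⟩
    · ext
      · rw [k1, p1]; ring
      · rw [k2, p2]; ring
    · ext
      · rw [Prod.fst_add, p1]; ring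
      · rw [Prod.snd_add, p2]; ring
  · left
    rw [h1] at n1 k1 k2
    have hbe : c = a := by
      by_contra hne
      have : c < a := lt_of_le_of_ne (by linarith) hne
      exact n1 (by norm_num) (by linarith)
    have p1 : (v (i + 2)).1 = a * (v (i + 1) - v i).1 := by
      have : (v (i + 2)).1 = c * (v (i + 1)).1 - a * (v i).1 := by
        rw [hc, ha]; simp only [detZ] at hN ⊢; linear_combination (-(v (i + 2)).1) * hN
      rw [this, hbe]; simp only [Prod.fst_sub]; ring
    have p2 : (v (i + 2)).2 = a * (v (i + 1) - v i).2 := by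
      have : (v (i + 2)).2 = c * (v (i + 1)).2 - a * (v i).2 := by
        rw [hc, ha]; simp only [detZ] at hN ⊢; linear_combination (-(v (i + 2)).2) * hN
      rw [this, hbe]; simp only [Prod.snd_sub]; ring
    have hb1 : a = 1 := by
      rcases h.prim_mul (i + 2) a _ p1 p2 with h2 | h2 <;> omega
    rw [hb1] at p1 p2
    simp only [Prod.fst_sub, Prod.snd_sub] at p1 p2
    refine ⟨h.inj ?_, ?_⟩
    · ext
      · rw [k1, p1]; ring
      · rw [k2, p2]; ring
    · ext
      · rw [Prod.fst_add, p1]; ring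
      · rw [Prod.snd_add, p2]; ring

lemma edge_self (i : ZMod d) (hN : detZ (v i) (v (i + 1)) = 1) :
    detZ (v i - v (i + 1)) (v i) = 1 ∧ detZ (v i - v (i + 1)) (v (i + 1)) = 1 := by
  simp only [detZ, Prod.fst_sub, Prod.snd_sub] at *
  constructor <;> linear_combination hN

/-- A contractible ray: its removal corresponds to a blow-down. -/
def Bad (v : ZMod d → ℤ × ℤ) (k : ZMod d) : Prop :=
  v k = v (k - 1) + v (k + 1) ∧ detZ (v (k - 1)) (v k) = 1

lemma edge_strict (h : GoodFan d v) (i k : ZMod d) (hN : detZ (v i) (v (i + 1)) = 1)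
    (hki : k ≠ i) (hki1 : k ≠ i + 1)
    (hnb : (k = i + 2 → ¬ Bad v (i + 1)) ∧ (k = i - 1 → ¬ Bad v i)) :
    detZ (v i - v (i + 1)) (v k) ≤ -1 := by
  obtain ⟨h1, h2⟩ := h.edge i k hN hki hki1
  by_contra hlt
  rcases h2 (by omega) with ⟨hk, hb⟩ | ⟨hk, hb⟩
  · apply hnb.1 hk
    have e1 : i + 1 - 1 = i := by ring
    have e2 : i + 1 + 1 = i + 2 := by ring
    unfold Bad
    rw [e1, e2]
    exact ⟨hb, hN⟩
  · apply hnb.2 hk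
    refine ⟨hb, ?_⟩
    simp only [detZ] at hN ⊢
    have b1 : (v (i - 1)).1 = (v i).1 - (v (i + 1)).1 := by rw [hb, Prod.fst_add]; simp
    have b2 : (v (i - 1)).2 = (v i).2 - (v (i + 1)).2 := by rw [hb, Prod.snd_add]; simp
    rw [b1, b2]; linear_combination hN

lemma pair_contra (h : GoodFan d v) (i j : ZMod d)
    (hk : ∀ k, detZ (v i - v (i + 1)) (v k) + detZ (v j - v (j + 1)) (v k) ≤ 0)
    (k : ZMod d)
    (hk0 : detZ (v i - v (i + 1)) (v k) + detZ (v j - v (j + 1)) (v k) < 0) : False := by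
  have e : ∀ k, detZ (v i - v (i + 1) + (v j - v (j + 1))) (v k) =
      detZ (v i - v (i + 1)) (v k) + detZ (v j - v (j + 1)) (v k) := by
    intro k; simp only [detZ, Prod.fst_add, Prod.snd_add]; ring
  have := h.functional (v i - v (i + 1) + (v j - v (j + 1))) (fun k => by rw [e]; exact hk k) k
  rw [e] at this
  omega

/-- Without contractible rays, two nonsingular cones share a ray. -/
lemma nobad_adj [NeZero d] (h : GoodFan d v) (hd : 5 ≤ d) (hb : ∀ k, ¬ Bad v k) (i j : ZMod d)
    (hi : detZ (v i) (v (i + 1)) = 1) (hj : detZ (v j) (v (j + 1)) = 1) :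
    j = i ∨ j = i + 1 ∨ i = j + 1 := by
  by_contra! hne
  obtain ⟨n1, n2, n3⟩ := hne
  obtain ⟨k, hk⟩ : ∃ k, k ∉ ({i, i + 1, j, j + 1} : Finset (ZMod d)) := by
    by_contra! hall
    have := Finset.card_le_card (fun x _ => hall x :
      (Finset.univ : Finset (ZMod d)) ⊆ {i, i + 1, j, j + 1})
    have h4 : ({i, i + 1, j, j + 1} : Finset (ZMod d)).card ≤ 4 := Finset.card_le_four
    rw [Finset.card_univ, ZMod.card] at this
    omega
  simp only [Finset.mem_insert, Finset.mem_singleton, not_or] at hk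
  have S : ∀ i, detZ (v i) (v (i + 1)) = 1 → ∀ k, k ≠ i → k ≠ i + 1 →
      detZ (v i - v (i + 1)) (v k) ≤ -1 := fun i hi k h1 h2 =>
    h.edge_strict i k hi h1 h2 ⟨fun _ => hb _, fun _ => hb _⟩
  have si := edge_self i hi
  have sj := edge_self j hj
  refine h.pair_contra i j (fun m => ?_) k ?_
  · by_cases m1 : m = i
    · subst m1
      have := S j hj m (Ne.symm n1) n3
      linarith [si.1]
    by_cases m2 : m = i + 1
    · subst m2
      have := S j hj (i + 1) (Ne.symm n2) (fun e => n1 (add_right_cancel e).symm)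
      linarith [si.2]
    have t1 := S i hi m m1 m2
    by_cases m3 : m = j
    · subst m3; linarith [sj.1]
    by_cases m4 : m = j + 1
    · subst m4; linarith [sj.2]
    linarith [S j hj m m3 m4]
  · linarith [S i hi k hk.1 hk.2.1, S j hj k hk.2.2.1 hk.2.2.2]

lemma num_ne (n : ℕ) (h0 : 0 < n) (hn : n < d) : (n : ZMod d) ≠ 0 := by
  intro e
  rw [ZMod.natCast_eq_zero_iff] at e
  exact absurd (Nat.le_of_dvd h0 e) (by omega)


/-- For at least seven rays, two nonsingular cones are at distance at most two. -/
lemma far (h : GoodFan d v) (hd : 7 ≤ d) (i j : ZMod d)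
    (hi : detZ (v i) (v (i + 1)) = 1) (hj : detZ (v j) (v (j + 1)) = 1) :
    j = i ∨ j = i + 1 ∨ j = i + 2 ∨ i = j + 1 ∨ i = j + 2 := by
  by_contra! hne
  obtain ⟨n1, n2, n3, n4, n5⟩ := hne
  have z1 : (1 : ZMod d) ≠ 0 := by exact_mod_cast num_ne (d := d) 1 (by norm_num) (by omega)
  have z2 : (2 : ZMod d) ≠ 0 := by exact_mod_cast num_ne (d := d) 2 (by norm_num) (by omega)
  have z3 : (3 : ZMod d) ≠ 0 := by exact_mod_cast num_ne (d := d) 3 (by norm_num) (by omega)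
  have z4 : (4 : ZMod d) ≠ 0 := by exact_mod_cast num_ne (d := d) 4 (by norm_num) (by omega)
  have z5 : (5 : ZMod d) ≠ 0 := by exact_mod_cast num_ne (d := d) 5 (by norm_num) (by omega)
  have z6 : (6 : ZMod d) ≠ 0 := by exact_mod_cast num_ne (d := d) 6 (by norm_num) (by omega)
  have S : ∀ i, detZ (v i) (v (i + 1)) = 1 → ∀ k, k ≠ i → k ≠ i + 1 → k ≠ i + 2 → k ≠ i - 1 →
      detZ (v i - v (i + 1)) (v k) ≤ -1 := fun i hi k h1 h2 h3 h4 =>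
    h.edge_strict i k hi h1 h2 ⟨fun e => absurd e h3, fun e => absurd e h4⟩
  have W : ∀ i, detZ (v i) (v (i + 1)) = 1 → ∀ k, k ≠ i → k ≠ i + 1 →
      detZ (v i - v (i + 1)) (v k) ≤ 0 := fun i hi k h1 h2 => (h.edge i k hi h1 h2).1
  have si := edge_self i hi
  have sj := edge_self j hj
  have all : ∀ m, detZ (v i - v (i + 1)) (v m) + detZ (v j - v (j + 1)) (v m) ≤ 0 := by
    intro m
    by_cases m1 : m = i
    · subst m1
      have := S j hj m 
        (fun e => n1 (by linear_combination -e))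
        (fun e => n4 (by linear_combination e))
        (fun e => n5 (by linear_combination e))
        (fun e => n2 (by linear_combination -e))
      linarith [si.1]
    by_cases m2 : m = i + 1
    · subst m2
      have := S j hj (i + 1) 
        (fun e => n2 (by linear_combination -e))
        (fun e => n1 (by linear_combination -e))
        (fun e => n4 (by linear_combination e))
        (fun e => n3 (by linear_combination -e))
      linarith [si.2]
    by_cases m3 : m = j
    · subst m3
      have := S i hi m 
        (fun e => n1 (by linear_combination e))
        (fun e => n2 (by linear_combination e))
        (fun e => n3 (by linear_combination e))
        (fun e => n4 (by linear_combination -e))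
      linarith [sj.1]
    by_cases m4 : m = j + 1
    · subst m4
      have := S i hi (j + 1) 
        (fun e => n4 (by linear_combination -e))
        (fun e => n1 (by linear_combination e))
        (fun e => n2 (by linear_combination e))
        (fun e => n5 (by linear_combination -e))
      linarith [sj.2]
    linarith [W i hi m m1 m2, W j hj m m3 m4]
  by_cases hj3 : j = i + 3
  · refine h.pair_contra i j all (i - 1) ?_
    have a1 := W i hi (i - 1) (fun e => z1 (by linear_combination -e)) (fun e => z2 (by linear_combination -e))
    have a2 := S j hj (i - 1) 
      (fun e => z4 (by linear_combination -e - hj3))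
      (fun e => z5 (by linear_combination -e - hj3))
      (fun e => z6 (by linear_combination -e - hj3))
      (fun e => z3 (by linear_combination -e - hj3))
    linarith
  · refine h.pair_contra i j all (i + 2) ?_
    have a1 := W i hi (i + 2) (fun e => z2 (by linear_combination e)) (fun e => z1 (by linear_combination e))
    have a2 := S j hj (i + 2) 
      (fun e => n3 (by linear_combination -e))
      (fun e => n2 (by linear_combination -e))
      (fun e => n1 (by linear_combination -e))
      (fun e => hj3 (by linear_combination -e))
    linarith

/-- The number of nonsingular cones. -/
lemma card_nonsing [NeZero d] (h : GoodFan d v) (hs : numSingular d v = 3) :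
    (Finset.univ.filter (fun i => detZ (v i) (v (i + 1)) = 1)).card + 3 = d := by
  classical
  have e : {i : ZMod d | 2 ≤ detZ (v i) (v (i + 1))} =
      ((Finset.univ.filter (fun i => ¬ detZ (v i) (v (i + 1)) = 1) : Finset (ZMod d)) :
        Set (ZMod d)) := by
    ext i
    have := h.det1 i
    simp only [Set.mem_ofPred_eq, Finset.coe_filter, Finset.mem_univ, true_and]
    omega
  unfold numSingular at hs
  rw [e, Set.ncard_coe_finset] at hs
  have := Finset.card_filter_add_card_filter_not (s := (Finset.univ : Finset (ZMod d)))
    (fun i => detZ (v i) (v (i + 1)) = 1)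
  rw [hs, Finset.card_univ, ZMod.card] at this
  exact this


lemma le_six [NeZero d] (h : GoodFan d v) (hs : numSingular d v = 3) : d ≤ 6 := by
  by_contra! hd
  have hc := h.card_nonsing hs
  obtain ⟨N, hN⟩ : ∃ N : Finset (ZMod d), N =
    Finset.univ.filter (fun i => detZ (v i) (v (i + 1)) = 1) := ⟨_, rfl⟩
  rw [← hN] at hc
  have mem : ∀ i, i ∈ N → detZ (v i) (v (i + 1)) = 1 := by
    intro i hi; rw [hN] at hi; exact (Finset.mem_filter.1 hi).2
  have far : ∀ i ∈ N, ∀ j ∈ N, j = i ∨ j = i + 1 ∨ j = i + 2 ∨ i = j + 1 ∨ i = j + 2 :=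
    fun i hi j hj => h.far hd i j (mem i hi) (mem j hj)
  have z1 : (1 : ZMod d) ≠ 0 := by exact_mod_cast num_ne (d := d) 1 (by norm_num) (by omega)
  have z2 : (2 : ZMod d) ≠ 0 := by exact_mod_cast num_ne (d := d) 2 (by norm_num) (by omega)
  have z3 : (3 : ZMod d) ≠ 0 := by exact_mod_cast num_ne (d := d) 3 (by norm_num) (by omega)
  have z4 : (4 : ZMod d) ≠ 0 := by exact_mod_cast num_ne (d := d) 4 (by norm_num) (by omega)
  have z5 : (5 : ZMod d) ≠ 0 := by exact_mod_cast num_ne (d := d) 5 (by norm_num) (by omega)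
  have z6 : (6 : ZMod d) ≠ 0 := by exact_mod_cast num_ne (d := d) 6 (by norm_num) (by omega)
  obtain ⟨i, hi⟩ : N.Nonempty := Finset.card_pos.1 (by omega)
  have key : ∀ a b c : ZMod d, (∀ j ∈ N, j = a ∨ j = b ∨ j = c) → False := by
    intro a b c hh
    have h1 : N ⊆ {a, b, c} := by
      intro j hj
      simpa using hh j hj
    have := Finset.card_le_card h1
    have : ({a, b, c} : Finset (ZMod d)).card ≤ 3 := Finset.card_le_three
    omega
  by_cases hm : i - 2 ∈ N
  · refine key (i - 2) (i - 1) i (fun j hj => ?_)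
    have f2 := far _ hm j hj
    rcases far i hi j hj with rfl | rfl | rfl | rfl | rfl
    · simp
    · exfalso
      rcases f2 with e | e | e | e | e
      · exact z3 (by linear_combination e)
      · exact z2 (by linear_combination e)
      · exact z1 (by linear_combination e)
      · exact z4 (by linear_combination -e)
      · exact z5 (by linear_combination -e)
    · exfalso
      rcases f2 with e | e | e | e | e
      · exact z4 (by linear_combination e)
      · exact z3 (by linear_combination e)
      · exact z2 (by linear_combination e)
      · exact z5 (by linear_combination -e)
      · exact z6 (by linear_combination -e)
    · right; left; ring
    · left; ring
  by_cases hp : i + 2 ∈ N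
  · refine key i (i + 1) (i + 2) (fun j hj => ?_)
    have f2 := far _ hp j hj
    rcases far i hi j hj with rfl | rfl | rfl | rfl | rfl
    · simp
    · simp
    · simp
    · exfalso
      rcases f2 with e | e | e | e | e
      · exact z3 (by linear_combination -e)
      · exact z4 (by linear_combination -e)
      · exact z5 (by linear_combination -e)
      · exact z2 (by linear_combination e)
      · exact z1 (by linear_combination e)
    · exfalso
      rcases f2 with e | e | e | e | e
      · exact z4 (by linear_combination -e)
      · exact z5 (by linear_combination -e)
      · exact z6 (by linear_combination -e)
      · exact z3 (by linear_combination e)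
      · exact z2 (by linear_combination e)
  refine key (i - 1) i (i + 1) (fun j hj => ?_)
  rcases far i hi j hj with rfl | rfl | rfl | rfl | rfl
  · simp
  · simp
  · exact absurd hj hp
  · left; ring
  · exfalso
    apply hm
    rwa [add_sub_cancel_right]

end GoodFan

/-- `numSingular` as a sum. -/
lemma numSingular_eq_sum (d : ℕ) [NeZero d] (v : ZMod d → ℤ × ℤ) :
    numSingular d v = ∑ i : ZMod d, if 2 ≤ detZ (v i) (v (i + 1)) then 1 else 0 := by
  classical
  unfold numSingular
  rw [← Finset.card_filter, ← Set.ncard_coe_finset]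
  congr 1
  ext i
  simp

namespace GoodFan

lemma six_bad {v : ZMod 6 → ℤ × ℤ} (h : GoodFan 6 v) (hs : numSingular 6 v = 3) :
    ∃ k, Bad v k := by
  by_contra! hb
  have hc := h.card_nonsing hs
  obtain ⟨N, hN⟩ : ∃ N : Finset (ZMod 6), N =
    Finset.univ.filter (fun i => detZ (v i) (v (i + 1)) = 1) := ⟨_, rfl⟩
  rw [← hN] at hc
  have adj : ∀ i ∈ N, ∀ j ∈ N, j = i ∨ j = i + 1 ∨ i = j + 1 := by
    intro i hi j hj
    rw [hN] at hi hj
    exact h.nobad_adj (by norm_num) hb i j (Finset.mem_filter.1 hi).2 (Finset.mem_filter.1 hj).2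
  clear hN
  have hc3 : N.card = 3 := by omega
  clear hc
  obtain ⟨a, b, c, hab, hac, hbc, rfl⟩ := Finset.card_eq_three.1 hc3
  have h1 := adj a (by simp) b (by simp)
  have h2 := adj a (by simp) c (by simp)
  have h3 := adj b (by simp) c (by simp)
  have fin6 : ∀ a b c : ZMod 6, ¬ (a ≠ b ∧ a ≠ c ∧ b ≠ c ∧ (b = a ∨ b = a + 1 ∨ a = b + 1) ∧
      (c = a ∨ c = a + 1 ∨ a = c + 1) ∧ (c = b ∨ c = b + 1 ∨ b = c + 1)) := by decide
  exact fin6 a b c ⟨hab, hac, hbc, h1, h2, h3⟩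

lemma five_adj {v : ZMod 5 → ℤ × ℤ} (h : GoodFan 5 v) (hs : numSingular 5 v = 3) :
    ∃ i, detZ (v i) (v (i + 1)) = 1 ∧ detZ (v (i + 1)) (v (i + 2)) = 1 ∧
      2 ≤ detZ (v (i + 2)) (v (i + 3)) ∧ 2 ≤ detZ (v (i + 3)) (v (i + 4)) ∧
      2 ≤ detZ (v (i + 4)) (v i) := by
  have hc := h.card_nonsing hs
  obtain ⟨N, hN⟩ : ∃ N : Finset (ZMod 5), N =
    Finset.univ.filter (fun i => detZ (v i) (v (i + 1)) = 1) := ⟨_, rfl⟩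
  rw [← hN] at hc
  have hc2 : N.card = 2 := by omega
  have mem : ∀ i, i ∈ N ↔ detZ (v i) (v (i + 1)) = 1 := by
    intro i; rw [hN]; simp
  obtain ⟨a, b, hab, hNab⟩ := Finset.card_eq_two.1 hc2
  have main : ∃ i, i ∈ N ∧ i + 1 ∈ N := by
    by_cases hb : ∃ k, Bad v k
    · obtain ⟨k, hk1, hk2⟩ := hb
      refine ⟨k - 1, ?_, ?_⟩
      · rw [mem]; simpa using hk2
      · rw [mem]
        simp only [sub_add_cancel]
        have e1 : (v k).1 = (v (k - 1)).1 + (v (k + 1)).1 := by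
          conv_lhs => rw [hk1]
          rfl
        have e2 : (v k).2 = (v (k - 1)).2 + (v (k + 1)).2 := by
          conv_lhs => rw [hk1]
          rfl
        simp only [detZ, e1, e2] at hk2 ⊢
        linear_combination hk2
    · push Not at hb
      have ha : a ∈ N := by rw [hNab]; simp
      have hb' : b ∈ N := by rw [hNab]; simp
      rcases h.nobad_adj (by norm_num) hb a b ((mem a).1 ha) ((mem b).1 hb') with e | e | e
      · exact absurd e.symm hab
      · exact ⟨a, ha, e ▸ hb'⟩
      · exact ⟨b, hb', e ▸ ha⟩
  obtain ⟨i, hi, hi1⟩ := main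
  have hNi : N = {i, i + 1} := by
    symm
    apply Finset.eq_of_subset_of_card_le
    · intro x hx
      simp only [Finset.mem_insert, Finset.mem_singleton] at hx
      rcases hx with rfl | rfl <;> assumption
    · rw [hc2, Finset.card_pair]
      clear * -; revert i; decide
  have sing : ∀ j, j ≠ i → j ≠ i + 1 → 2 ≤ detZ (v j) (v (j + 1)) := by
    intro j h1 h2
    have : j ∉ N := by rw [hNi]; simp [h1, h2]
    rw [mem] at this
    have := h.det1 j
    omega
  have q1 : i + 1 + 1 = i + 2 := by ring
  have q2 : i + 2 + 1 = i + 3 := by ring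
  have q3 : i + 3 + 1 = i + 4 := by ring
  have q4 : i + 4 + 1 = i := by clear * -; revert i; decide
  refine ⟨i, (mem i).1 hi, ?_, ?_, ?_, ?_⟩
  · have := (mem _).1 hi1
    rwa [q1] at this
  · have := sing (i + 2) (by clear * -; revert i; decide) (by clear * -; revert i; decide)
    rwa [q2] at this
  · have := sing (i + 3) (by clear * -; revert i; decide) (by clear * -; revert i; decide)
    rwa [q3] at this
  · have := sing (i + 4) (by clear * -; revert i; decide) (by clear * -; revert i; decide)
    rwa [q4] at this

/-- Unimodular coordinates of a primitive vector are coprime. -/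
lemma gcd_coords {a b x : ℤ × ℤ} (hab : detZ a b = 1) (hx : Int.gcd x.1 x.2 = 1) :
    Int.gcd (detZ x b) (detZ a x) = 1 := by
  rw [← Int.isCoprime_iff_gcd_eq_one] at hx ⊢
  obtain ⟨m, n, hmn⟩ := hx
  refine ⟨m * a.1 + n * a.2, m * b.1 + n * b.2, ?_⟩
  simp only [detZ] at *
  linear_combination hmn + (m * x.1 + n * x.2) * hab

lemma five_case {v : ZMod 5 → ℤ × ℤ} (h : GoodFan 5 v) (hs : numSingular 5 v = 3) :
    ∃ p q r s t : ℤ,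
      p ≤ 1 ∧
      r ≤ min (min (-1) (-p * q - 2))
            (min (q - p * q - 1) (-p * q + q * t - r * s + p * s + t - 1)) ∧
      t ≤ min (min (-2) (-s - 1)) (q * t - r * s + r - 1) ∧
      2 ≤ q * t - r * s ∧
      Int.gcd q r = 1 ∧ Int.gcd s t = 1 ∧
      FanEquiv v (data5' p q r s t) := by
  obtain ⟨i, h01, h12, h23, h34, h40⟩ := h.five_adj hs
  have q1 : i + 1 + 1 = i + 2 := by ring
  have q2 : i + 2 + 1 = i + 3 := by ring
  have q3 : i + 3 + 1 = i + 4 := by ring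
  have q4 : i + 4 + 1 = i := by clear * -; revert i; decide
  have r0 : i - 1 = i + 4 := by clear * -; revert i; decide
  have r1 : i + 1 - 1 = i := by ring
  have r2 : i + 2 - 1 = i + 1 := by ring
  have r3 : i + 3 - 1 = i + 2 := by ring
  have r4 : i + 4 - 1 = i + 3 := by ring
  have f0 := h.fpos i
  have f1 := h.fpos (i + 1)
  have f2 := h.fpos (i + 2)
  have f3 := h.fpos (i + 3)
  have f4 := h.fpos (i + 4)
  have nb0 : ¬ Bad v i := by
    rintro ⟨-, hb⟩
    rw [r0] at hb; omega
  have nb2 : ¬ Bad v (i + 1 + 1) := by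
    rintro ⟨hb, hb'⟩
    rw [q1, r2, q2] at hb
    have e1 : (v (i + 2)).1 = (v (i + 1)).1 + (v (i + 3)).1 := by rw [hb]; rfl
    have e2 : (v (i + 2)).2 = (v (i + 1)).2 + (v (i + 3)).2 := by rw [hb]; rfl
    have : detZ (v (i + 2)) (v (i + 3)) = detZ (v (i + 1)) (v (i + 2)) := by
      simp only [detZ, e1, e2]; ring
    omega
  have L3 := h.edge_strict i (i + 4) h01 (by clear * -; revert i; decide)
    (by clear * -; revert i; decide) ⟨fun e => absurd e (by clear * -; revert i; decide), fun _ => nb0⟩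
  have L1 := h.edge_strict i (i + 3) h01 (by clear * -; revert i; decide)
    (by clear * -; revert i; decide) ⟨fun e => absurd e (by clear * -; revert i; decide), fun _ => nb0⟩
  have L2 := h.edge_strict (i + 1) (i + 3) (by rw [q1]; exact h12) (by clear * -; revert i; decide)
    (by clear * -; revert i; decide)
    ⟨fun _ => nb2, fun e => absurd e (by clear * -; revert i; decide)⟩
  simp only [fanF, q1, q2, q3, q4, r0, r1, r2, r3, r4] at f0 f1 f2 f3 f4 L2
  have g3 := gcd_coords h01 (h.prim (i + 3))
  have g4 := gcd_coords h01 (h.prim (i + 4))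
  clear nb0 nb2 q1 q2 q3 r0 r1 r2 r3 r4
  -- coordinates
  have coord : ∀ k, v k = (detZ (v k) (v (i + 1)) * (v i).1 + detZ (v i) (v k) * (v (i + 1)).1,
      detZ (v k) (v (i + 1)) * (v i).2 + detZ (v i) (v k) * (v (i + 1)).2) := by
    intro k
    simp only [detZ] at h01 ⊢
    ext
    · linear_combination (-(v k).1) * h01
    · linear_combination (-(v k).2) * h01
  have dets : ∀ k l, detZ (v k) (v l) = detZ (v k) (v (i + 1)) * detZ (v i) (v l)
      - detZ (v i) (v k) * detZ (v l) (v (i + 1)) := by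
    intro k l
    have e : detZ (v i) (v (i + 1)) * detZ (v k) (v l) = detZ (v k) (v (i + 1)) * detZ (v i) (v l)
      - detZ (v i) (v k) * detZ (v l) (v (i + 1)) := by
      simp only [detZ]; ring
    rwa [h01, one_mul] at e
  have m12 : detZ (v (i + 2)) (v (i + 1)) = -1 := by
    rw [← h12]; simp only [detZ]; ring
  have s30 : detZ (v i) (v i) = 0 := by simp only [detZ]; ring
  have s31 : detZ (v (i + 1)) (v (i + 1)) = 0 := by simp only [detZ]; ring
  have sub : ∀ a b c : ℤ × ℤ, detZ (a - b) c = detZ a c - detZ b c := by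
    intro a b c; simp only [detZ, Prod.fst_sub, Prod.snd_sub]; ring
  rw [sub] at L1 L2 L3
  rw [dets (i + 1) (i + 3)] at L1
  rw [dets (i + 1) (i + 4)] at L3
  rw [dets (i + 1) (i + 3), dets (i + 2) (i + 3)] at L2
  rw [dets (i + 2) (i + 3)] at h23
  rw [dets (i + 3) (i + 4)] at h34
  rw [dets (i + 4) i] at h40
  rw [dets (i + 3) (i + 4), dets (i + 4) i] at f4
  rw [dets (i + 3) (i + 4), dets (i + 2) (i + 3), dets (i + 4) (i + 2)] at f3
  rw [dets (i + 1) (i + 2), dets (i + 2) i] at f1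
  simp only [s30, s31, m12, h01] at L1 L2 L3 h23 h34 h40 f1 f3 f4
  obtain ⟨p, hp⟩ : ∃ p, p = detZ (v i) (v (i + 2)) := ⟨_, rfl⟩
  obtain ⟨q, hq⟩ : ∃ q, q = detZ (v (i + 3)) (v (i + 1)) := ⟨_, rfl⟩
  obtain ⟨r, hr⟩ : ∃ r, r = detZ (v i) (v (i + 3)) := ⟨_, rfl⟩
  obtain ⟨s, hs'⟩ : ∃ s, s = detZ (v (i + 4)) (v (i + 1)) := ⟨_, rfl⟩
  obtain ⟨t, ht⟩ : ∃ t, t = detZ (v i) (v (i + 4)) := ⟨_, rfl⟩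
  simp only [← hp, ← hq, ← hr, ← hs', ← ht] at L1 L2 L3 h23 h34 h40 f1 f3 f4 g3 g4
  have hp1 : p ≤ 1 := by linarith
  have hr1 : r ≤ -1 := by
    by_contra hr0
    have : 0 ≤ r := by omega
    nlinarith
  refine ⟨p, q, r, s, t, hp1, ?_, ?_, by linarith, g3, g4, ?_⟩
  · simp only [le_min_iff]
    refine ⟨⟨hr1, by linarith⟩, by linarith, by linarith⟩
  · simp only [le_min_iff]
    refine ⟨⟨by linarith, by linarith⟩, by linarith⟩
  · refine ⟨!![(v (i + 1)).2, -(v (i + 1)).1; -(v i).2, (v i).1], ?_, ?_⟩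
    · rw [Matrix.det_fin_two_of]
      have : (v (i + 1)).2 * (v i).1 - -(v (i + 1)).1 * -(v i).2 = 1 := by
        rw [← h01]; simp only [detZ]; ring
      rw [this]; exact isUnit_one
    · have hfun : (fun u : ℤ × ℤ =>
          ((!![(v (i + 1)).2, -(v (i + 1)).1; -(v i).2, (v i).1] : Matrix (Fin 2) (Fin 2) ℤ) 0 0 * u.1
            + (!![(v (i + 1)).2, -(v (i + 1)).1; -(v i).2, (v i).1] : Matrix (Fin 2) (Fin 2) ℤ) 0 1 * u.2,
           (!![(v (i + 1)).2, -(v (i + 1)).1; -(v i).2, (v i).1] : Matrix (Fin 2) (Fin 2) ℤ) 1 0 * u.1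
            + (!![(v (i + 1)).2, -(v (i + 1)).1; -(v i).2, (v i).1] : Matrix (Fin 2) (Fin 2) ℤ) 1 1 * u.2))
          = fun u => (detZ u (v (i + 1)), detZ (v i) u) := by
        funext u
        simp [detZ]
        constructor <;> ring
      rw [hfun, ← Set.range_comp]
      have hcomp : ∀ j : ZMod 5, ((fun u => (detZ u (v (i + 1)), detZ (v i) u)) ∘ v) (i + j)
          = data5' p q r s t j := by
        intro j
        have hj : j = 0 ∨ j = 1 ∨ j = 2 ∨ j = 3 ∨ j = 4 := by clear * -; revert j; decide
        rcases hj with rfl | rfl | rfl | rfl | rfl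
        · simp only [Function.comp, add_zero, h01, s30]; rfl
        · simp only [Function.comp, h01, s31]; rfl
        · simp only [Function.comp, m12, ← hp]; rfl
        · simp only [Function.comp, ← hq, ← hr]; rfl
        · simp only [Function.comp, ← hs', ← ht]; rfl
      ext x
      constructor
      · rintro ⟨k, rfl⟩
        refine ⟨k - i, ?_⟩
        rw [← hcomp, add_sub_cancel]
      · rintro ⟨j, rfl⟩
        exact ⟨i + j, hcomp j⟩

end GoodFan

/-- Blowing down a contractible ray of a hexagon. -/
lemma six_case {v : ZMod 6 → ℤ × ℤ} (hL : IsLDPFanData 6 v) (hs : numSingular 6 v = 3)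
    (k : ZMod 6) (hb : GoodFan.Bad v k) :
    v k = v (k - 1) + v (k + 1) ∧
      detZ (v (k - 1)) (v k) = 1 ∧
      detZ (v k) (v (k + 1)) = 1 ∧
      IsLDPFanData (6 - 1) (deleteAt v k) ∧
      numSingular (6 - 1) (deleteAt v k) = 3 := by
  have h := hL.goodFan
  obtain ⟨⟨-, hp, hd, hc, hi⟩, hf⟩ := hL
  obtain ⟨hb1, hb2⟩ := hb
  have e1 : (v (k - 1)).1 = (v k).1 - (v (k + 1)).1 := by
    have := congrArg Prod.fst hb1; simp only [Prod.fst_add] at this; linarith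
  have e2 : (v (k - 1)).2 = (v k).2 - (v (k + 1)).2 := by
    have := congrArg Prod.snd hb1; simp only [Prod.snd_add] at this; linarith
  have hb3 : detZ (v k) (v (k + 1)) = 1 := by
    rw [← hb2]; simp only [detZ, e1, e2]; ring
  have hb4 : detZ (v (k - 1)) (v (k + 1)) = 1 := by
    rw [← hb3]; simp only [detZ, e1, e2]; ring
  have a1 : k + 1 + 1 = k + 2 := by ring
  have a2 : k + 2 + 1 = k + 3 := by ring
  have a3 : k + 3 + 1 = k + 4 := by ring
  have a4 : k + 4 + 1 = k - 1 := by clear * -; revert k; decide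
  have s1 : k + 1 - 1 = k := by ring
  have s2 : k + 2 - 1 = k + 1 := by ring
  have s3 : k + 3 - 1 = k + 2 := by ring
  have s4 : k + 4 - 1 = k + 3 := by ring
  have s5 : k - 1 - 1 = k + 4 := by clear * -; revert k; decide
  have s6 : k - 1 + 1 = k := by ring
  refine ⟨hb1, hb2, hb3, ?_⟩
  show IsLDPFanData 5 (deleteAt v k) ∧ numSingular 5 (deleteAt v k) = 3
  obtain ⟨w, hw⟩ : ∃ w : ZMod 5 → ℤ × ℤ, w = deleteAt v k := ⟨_, rfl⟩
  rw [← hw]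
  have w0 : w 0 = v (k + 1) := by rw [hw]; exact congrArg v (by clear * -; revert k; decide)
  have w1 : w 1 = v (k + 2) := by rw [hw]; exact congrArg v (by clear * -; revert k; decide)
  have w2 : w 2 = v (k + 3) := by rw [hw]; exact congrArg v (by clear * -; revert k; decide)
  have w3 : w 3 = v (k + 4) := by rw [hw]; exact congrArg v (by clear * -; revert k; decide)
  have w4 : w 4 = v (k - 1) := by rw [hw]; exact congrArg v (by clear * -; revert k; decide)
  clear hw
  have t0 : (0 : ZMod 5) + 1 = 1 := by decide
  have t1 : (1 : ZMod 5) + 1 = 2 := by decide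
  have t2 : (2 : ZMod 5) + 1 = 3 := by decide
  have t3 : (3 : ZMod 5) + 1 = 4 := by decide
  have t4 : (4 : ZMod 5) + 1 = 0 := by decide
  have u0 : (0 : ZMod 5) - 1 = 4 := by decide
  have u1 : (1 : ZMod 5) - 1 = 0 := by decide
  have u2 : (2 : ZMod 5) - 1 = 1 := by decide
  have u3 : (3 : ZMod 5) - 1 = 2 := by decide
  have u4 : (4 : ZMod 5) - 1 = 3 := by decide
  have c5 : ∀ j : ZMod 5, j = 0 ∨ j = 1 ∨ j = 2 ∨ j = 3 ∨ j = 4 := by decide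
  have d1 := hd (k + 1)
  have d2 := hd (k + 2)
  have d3 := hd (k + 3)
  have d4 := hd (k + 4)
  rw [a1] at d1
  rw [a2] at d2
  rw [a3] at d3
  rw [a4] at d4
  have wd : ∀ j, 1 ≤ detZ (w j) (w (j + 1)) := by
    intro j
    rcases c5 j with rfl | rfl | rfl | rfl | rfl
    · rw [t0, w0, w1]; exact d1
    · rw [t1, w1, w2]; exact d2
    · rw [t2, w2, w3]; exact d3
    · rw [t3, w3, w4]; exact d4
    · rw [t4, w4, w0, hb4]
  -- every cone except the last one is an old cone
  have old : ∀ j : ZMod 5, j ≠ 4 → ∃ m : ZMod 6, m = k + 1 + (j.val : ZMod 6) ∧ m ≠ k ∧ m ≠ k - 1 ∧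
      w j = v m ∧ w (j + 1) = v (m + 1) := by
    intro j hj
    refine ⟨_, rfl, ?_⟩
    rcases c5 j with rfl | rfl | rfl | rfl | rfl
    · refine ⟨by clear * -; revert k; decide, by clear * -; revert k; decide, ?_, ?_⟩
      · rw [w0]; exact congrArg v (by clear * -; revert k; decide)
      · rw [t0, w1]; exact congrArg v (by clear * -; revert k; decide)
    · refine ⟨by clear * -; revert k; decide, by clear * -; revert k; decide, ?_, ?_⟩
      · rw [w1]; exact congrArg v (by clear * -; revert k; decide)
      · rw [t1, w2]; exact congrArg v (by clear * -; revert k; decide)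
    · refine ⟨by clear * -; revert k; decide, by clear * -; revert k; decide, ?_, ?_⟩
      · rw [w2]; exact congrArg v (by clear * -; revert k; decide)
      · rw [t2, w3]; exact congrArg v (by clear * -; revert k; decide)
    · refine ⟨by clear * -; revert k; decide, by clear * -; revert k; decide, ?_, ?_⟩
      · rw [w3]; exact congrArg v (by clear * -; revert k; decide)
      · rw [t3, w4]; exact congrArg v (by clear * -; revert k; decide)
    · exact absurd rfl hj
  have disj4 : ∀ j : ZMod 5, j ≠ 4 → ∀ x, x ∈ interior (coneOf (w j) (w (j + 1))) →
      x ∈ interior (coneOf (w 4) (w (4 + 1))) → False := by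
    intro j hj x hx hx4
    obtain ⟨m, -, hmk, hmk1, hm1, hm2⟩ := old j hj
    rw [hm1, hm2] at hx
    have hx' := (mem_interior_coneOf_iff (hd m) x).1 hx
    rw [mem_interior_coneOf_iff (wd 4), t4, w4, w0] at hx4
    obtain ⟨y1, y2⟩ := hx4
    have E1 : (toR2 (v (k - 1))) = toR2 (v k) - toR2 (v (k + 1)) := by
      ext
      · simp [toR2, e1]
      · simp [toR2, e2]
    rcases lt_trichotomy (dR (toR2 (v k)) x) 0 with hz | hz | hz
    · -- in the cone before `k`
      have hin : x ∈ interior (coneOf (v (k - 1)) (v (k - 1 + 1))) := by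
        rw [mem_interior_coneOf_iff (hd (k - 1)), s6]
        refine ⟨y1, ?_⟩
        have : dR x (toR2 (v k)) = - dR (toR2 (v k)) x := by simp only [dR]; ring
        rw [this]; linarith
      have : x ∈ (∅ : Set (ℝ × ℝ)) := by rw [← hi m (k - 1) hmk1]; exact ⟨hx, hin⟩
      exact this
    · -- on the ray of `v k`
      have hD : dR (toR2 (v k)) (toR2 (v (k + 1))) = 1 := by rw [dR_toR2, hb3]; norm_num
      have hx1 : x = dR x (toR2 (v (k + 1))) • toR2 (v k) := by
        simp only [dR] at hz hD ⊢
        ext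
        · simp only [Prod.smul_fst, smul_eq_mul]
          linear_combination (toR2 (v (k + 1))).1 * hz - x.1 * hD
        · simp only [Prod.smul_snd, smul_eq_mul]
          linear_combination (toR2 (v (k + 1))).2 * hz - x.2 * hD
      obtain ⟨c, hcc⟩ : ∃ c, c = dR x (toR2 (v (k + 1))) := ⟨_, rfl⟩
      rw [← hcc] at hx1 y2
      rw [hx1] at hx'
      have g1 : dR (toR2 (v m)) (c • toR2 (v k)) = c * (detZ (v m) (v k) : ℝ) := by
        rw [← dR_toR2]; simp only [dR, Prod.smul_fst, Prod.smul_snd, smul_eq_mul]; ring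
      have g2 : dR (c • toR2 (v k)) (toR2 (v (m + 1))) = c * (detZ (v k) (v (m + 1)) : ℝ) := by
        rw [← dR_toR2]; simp only [dR, Prod.smul_fst, Prod.smul_snd, smul_eq_mul]; ring
      rw [g1, g2] at hx'
      have g3 := (mul_pos_iff_of_pos_left y2).1 hx'.1
      have g4 := (mul_pos_iff_of_pos_left y2).1 hx'.2
      exact h.not_open m k (by exact_mod_cast g3) (by exact_mod_cast g4)
    · -- in the cone after `k`
      have hin : x ∈ interior (coneOf (v k) (v (k + 1))) := by
        rw [mem_interior_coneOf_iff (hd k)]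
        exact ⟨hz, y2⟩
      have : x ∈ (∅ : Set (ℝ × ℝ)) := by rw [← hi m k hmk]; exact ⟨hx, hin⟩
      exact this
  refine ⟨⟨⟨by norm_num, ?_, wd, ?_, ?_⟩, ?_⟩, ?_⟩
  · intro j
    rcases c5 j with rfl | rfl | rfl | rfl | rfl
    · rw [w0]; exact hp _
    · rw [w1]; exact hp _
    · rw [w2]; exact hp _
    · rw [w3]; exact hp _
    · rw [w4]; exact hp _
  · rw [Set.eq_univ_iff_forall]
    intro x
    have hx : x ∈ ⋃ i, coneOf (v i) (v (i + 1)) := by rw [hc]; trivial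
    obtain ⟨m, hm⟩ := Set.mem_iUnion.1 hx
    rw [Set.mem_iUnion]
    have c6 : m = k + 1 ∨ m = k + 2 ∨ m = k + 3 ∨ m = k + 4 ∨ m = k - 1 ∨ m = k := by
      clear * -; revert m k; decide
    rcases c6 with rfl | rfl | rfl | rfl | rfl | rfl
    · exact ⟨0, by rw [t0, w0, w1]; rwa [a1] at hm⟩
    · exact ⟨1, by rw [t1, w1, w2]; rwa [a2] at hm⟩
    · exact ⟨2, by rw [t2, w2, w3]; rwa [a3] at hm⟩
    · exact ⟨3, by rw [t3, w3, w4]; rwa [a4] at hm⟩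
    · refine ⟨4, ?_⟩
      rw [t4, w4, w0]
      rw [s6] at hm
      obtain ⟨a, b, ha, hb, rfl⟩ := hm
      refine ⟨a + b, b, by linarith, hb, ?_⟩
      rw [hb1]
      ext <;> simp [toR2] <;> ring
    · refine ⟨4, ?_⟩
      rw [t4, w4, w0]
      obtain ⟨a, b, ha, hb, rfl⟩ := hm
      refine ⟨a, a + b, ha, by linarith, ?_⟩
      rw [hb1]
      ext <;> simp [toR2] <;> ring
  · intro i j hij
    rw [Set.eq_empty_iff_forall_notMem]
    rintro x ⟨hx1, hx2⟩
    by_cases hi4 : i = 4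
    · subst hi4
      exact disj4 j (Ne.symm hij) x hx2 hx1
    by_cases hj4 : j = 4
    · subst hj4
      exact disj4 i hij x hx1 hx2
    obtain ⟨m, hm, -, -, hm1, hm2⟩ := old i hi4
    obtain ⟨n, hn, -, -, hn1, hn2⟩ := old j hj4
    rw [hm1, hm2] at hx1
    rw [hn1, hn2] at hx2
    have hmn : m ≠ n := by
      rw [hm, hn]; clear * - hij; revert i j k; decide
    have : x ∈ (∅ : Set (ℝ × ℝ)) := by rw [← hi m n hmn]; exact ⟨hx1, hx2⟩
    exact this
  · have f1 := hf (k + 1)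
    have f2 := hf (k + 2)
    have f3 := hf (k + 3)
    have f4 := hf (k + 4)
    have f5 := hf (k - 1)
    intro j
    simp only [fanF, a1, a2, a3, a4, s1, s2, s3, s4, s5, s6] at f1 f2 f3 f4 f5
    rcases c5 j with rfl | rfl | rfl | rfl | rfl
    · rw [fanF, t0, u0, w4, w0, w1]
      simp only [detZ, e1, e2] at *
      linarith
    · rw [fanF, t1, u1, w0, w1, w2]; exact f2
    · rw [fanF, t2, u2, w1, w2, w3]; exact f3
    · rw [fanF, t3, u3, w2, w3, w4]; exact f4
    · rw [fanF, t4, u4, w3, w4, w0]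
      simp only [detZ, e1, e2] at *
      linarith
  · rw [numSingular_eq_sum] at hs ⊢
    rw [← Equiv.sum_comp (Equiv.addLeft k)] at hs
    have sum6 : ∀ F : ZMod 6 → ℕ, ∑ i, F i = F 0 + F 1 + F 2 + F 3 + F 4 + F 5 :=
      fun F => Fin.sum_univ_six F
    have sum5 : ∀ F : ZMod 5 → ℕ, ∑ i, F i = F 0 + F 1 + F 2 + F 3 + F 4 :=
      fun F => Fin.sum_univ_five F
    have a5 : k + 5 = k - 1 := by clear * -; revert k; decide
    rw [sum6] at hs
    rw [sum5]
    simp only [Equiv.coe_addLeft, add_zero, a1, a2, a3, a4, a5, s6, hb3, hb2] at hs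
    simp only [t0, t1, t2, t3, t4, w0, w1, w2, w3, w4, hb4]
    norm_num at hs ⊢
    exact hs

/-- Classification of toric log del Pezzo surfaces with exactly three singular points. -/
theorem classification_three_singular_points
    (d : ℕ) (v : ZMod d → ℤ × ℤ) (h : IsLDPFanData d v) (hs : numSingular d v = 3) :
    d ≤ 4 ∨
    (d = 5 ∧ ∃ p q r s t : ℤ,
      p ≤ 1 ∧
      r ≤ min (min (-1) (-p * q - 2))
            (min (q - p * q - 1) (-p * q + q * t - r * s + p * s + t - 1)) ∧
      t ≤ min (min (-2) (-s - 1)) (q * t - r * s + r - 1) ∧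
      2 ≤ q * t - r * s ∧
      Int.gcd q r = 1 ∧ Int.gcd s t = 1 ∧
      FanEquiv v (data5' p q r s t)) ∨
    (d = 6 ∧ ∃ k : ZMod d,
      v k = v (k - 1) + v (k + 1) ∧
      detZ (v (k - 1)) (v k) = 1 ∧
      detZ (v k) (v (k + 1)) = 1 ∧
      IsLDPFanData (d - 1) (deleteAt v k) ∧
      numSingular (d - 1) (deleteAt v k) = 3) := by
  have h3 : 3 ≤ d := h.1.1
  have : NeZero d := ⟨by omega⟩
  have hg := h.goodFan
  have h6 := hg.le_six hs
  by_cases h4 : d ≤ 4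
  · exact Or.inl h4
  right
  obtain rfl | rfl : d = 5 ∨ d = 6 := by omega
  · exact Or.inl ⟨rfl, hg.five_case hs⟩
  · obtain ⟨k, hk⟩ := hg.six_bad hs
    exact Or.inr ⟨rfl, k, six_case h hs k hk⟩
end
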